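/- arXiv:1809.06916 — 5 statements merged into one kernel-verified Lean document; each statement's English description precedes it below -/
import Mathlib

section
/- Let m ∈ ℕ, let ν be a Borel probability measure on ℝ^m, and let X be an ergodic ℝ^m-system. If ν(W(X) + β) > 0 for some β ∈ ℝ^m (measure understood as outer measure if the set is non-measurable), then ν is not weakly equidistributed for X. -/
open MeasureTheory Filter Topology

structure RSystem (m : ℕ) (X : Type*) [MeasurableSpace X] (μ : Measure X) where
  T : (Fin m → ℝ) → X → X
  measurable_pair : Measurable fun p : (Fin m → ℝ) × X => T p.1 p.2
  measurePreserving : ∀ α, MeasurePreserving (T α) μ μ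
  T_zero : T 0 = id
  T_add : ∀ α β, T α ∘ T β = T (α + β)
  separableL2 : TopologicalSpace.SeparableSpace (Lp ℂ 2 μ)

namespace RSystem

variable {m : ℕ} {X : Type*} [MeasurableSpace X] {μ : Measure X}

/-- The system is ergodic. -/
def IsErgodic (S : RSystem m X μ) : Prop :=
  ∀ A : Set X, MeasurableSet A → (∀ α, μ (symmDiff (S.T α ⁻¹' A) A) = 0) →
    μ A = 0 ∨ μ A = 1

end RSystem

/-- A set of reals has density one. -/
def HasDensityOne (A : Set ℝ) : Prop :=
  Tendsto (fun T' : ℝ => (volume (A ∩ Set.Icc 0 T')).toReal / T') atTop (nhds 1)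

namespace RSystem

variable {m : ℕ} {X : Type*} [MeasurableSpace X] {μ : Measure X}

/-- `ν` is weakly equidistributed for the system. -/
def WeaklyEquidistributed (S : RSystem m X μ) (ν : Measure (Fin m → ℝ)) : Prop :=
  ∃ A : Set ℝ, MeasurableSet A ∧ HasDensityOne A ∧
    ∀ f : X → ℂ, Measurable f → (∃ C, ∀ x, ‖f x‖ ≤ C) →
      ∀ᵐ x ∂μ, Tendsto (fun t : ℝ => ∫ α, f (S.T (t • α) x) ∂ν)
        (atTop ⊓ Filter.principal A) (nhds (∫ x, f x ∂μ))

/-- The system is good for double Birkhoff averages. -/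
def GoodForDoubleBirkhoff (S : RSystem m X μ) : Prop :=
  ∀ (f₁ f₂ : X → ℂ), Measurable f₁ → Measurable f₂ →
    (∃ C, ∀ x, ‖f₁ x‖ ≤ C) → (∃ C, ∀ x, ‖f₂ x‖ ≤ C) →
    ∀ α₁ α₂ : Fin m → ℝ, ∀ᵐ x ∂μ, ∃ L : ℂ,
      Tendsto (fun T' : ℝ => (1 / T' : ℝ) •
          ∫ t in Set.Ioc (0:ℝ) T', f₁ (S.T (t • α₁) x) * f₂ (S.T (t • α₂) x))
        atTop (nhds L)

/-- The σ-algebra (collection of sets) invariant under `T_g`, `g ∈ H`, up to null sets. -/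
def InvSets (S : RSystem m X μ) (H : Set (Fin m → ℝ)) : Set (Set X) :=
  {A | MeasurableSet A ∧ ∀ g ∈ H, μ (symmDiff (S.T g ⁻¹' A) A) = 0}

/-- The set of non-ergodic directions. -/
def W (S : RSystem m X μ) : Set (Fin m → ℝ) :=
  {α | S.InvSets (Set.range fun t : ℝ => t • α) ≠ S.InvSets Set.univ}

end RSystem

/-- A hyperplane of `ℝ^m`: a translate of an `(m-1)`-dimensional linear subspace. -/
def IsHyperplane (m : ℕ) (ℓ : Set (Fin m → ℝ)) : Prop :=
  ∃ (V : Submodule ℝ (Fin m → ℝ)) (β : Fin m → ℝ),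
    Module.finrank ℝ V = m - 1 ∧ ℓ = (fun v => v + β) '' (V : Set (Fin m → ℝ))

namespace RSystem

/-- The autocorrelation of `g` at `γ`. -/
noncomputable def corr {m : ℕ} {X : Type*} [MeasurableSpace X] {μ : Measure X}
    (S : RSystem m X μ) (g : X → ℝ) (γ : Fin m → ℝ) : ℝ :=
  ∫ x, g (S.T γ x) * g x ∂μ

section Lemmas

variable {m : ℕ} {X : Type*} [MeasurableSpace X] {μ : Measure X} (S : RSystem m X μ)

lemma measurable_T (α : Fin m → ℝ) : Measurable (S.T α) := (S.measurePreserving α).measurable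

lemma T_add_apply (α β : Fin m → ℝ) (x : X) : S.T (α + β) x = S.T α (S.T β x) := by
  rw [← S.T_add]; rfl

variable {g : X → ℝ}

lemma corr_sub (hg : Measurable g) (a b : Fin m → ℝ) :
    ∫ x, g (S.T a x) * g (S.T b x) ∂μ = S.corr g (a - b) := by
  have h : ∀ x, S.T a x = S.T (a - b) (S.T b x) := fun x => by
    rw [← T_add_apply, sub_add_cancel]
  have hm := integral_map (μ := μ) (S.measurable_T b).aemeasurable
    ((hg.comp (S.measurable_T (a - b))).mul hg).aestronglyMeasurable
  rw [(S.measurePreserving b).map_eq] at hm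
  refine Eq.trans ?_ hm.symm
  simp only [h, Pi.mul_apply, Function.comp_apply]

lemma corr_neg (hg : Measurable g) (γ : Fin m → ℝ) : S.corr g (-γ) = S.corr g γ := by
  rw [← zero_sub, ← S.corr_sub hg, ← sub_zero γ, ← S.corr_sub hg, sub_zero]
  simp only [mul_comm]

lemma measurable_pair_smul (hg : Measurable g) (t : ℝ) :
    Measurable fun p : X × (Fin m → ℝ) => g (S.T (t • p.2) p.1) :=
  hg.comp (S.measurable_pair.comp ((measurable_snd.const_smul t).prodMk measurable_fst))

variable [IsProbabilityMeasure μ]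

lemma abs_corr_le_one (hb : ∀ x, |g x| ≤ 1) (γ : Fin m → ℝ) : |S.corr g γ| ≤ 1 := by
  have := norm_integral_le_of_norm_le_const (μ := μ) (C := 1)
    (f := fun x => g (S.T γ x) * g x) (ae_of_all _ fun x => by
      rw [norm_mul]; exact mul_le_one₀ (hb _) (norm_nonneg _) (hb _))
  simpa [corr] using this

lemma sum_corr_nonneg (hg : Measurable g) (hb : ∀ x, |g x| ≤ 1) (N : ℕ) (u : ℕ → Fin m → ℝ) :
    0 ≤ ∑ i ∈ Finset.range N, ∑ j ∈ Finset.range N, S.corr g (u i - u j) := by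
  have hint : ∀ i j, Integrable (fun x => g (S.T (u i) x) * g (S.T (u j) x)) μ := fun i j =>
    Integrable.of_bound ((hg.comp (S.measurable_T _)).mul
      (hg.comp (S.measurable_T _))).aestronglyMeasurable 1 (ae_of_all _ fun x => by
        rw [norm_mul]; exact mul_le_one₀ (hb _) (norm_nonneg _) (hb _))
  have h : ∑ i ∈ Finset.range N, ∑ j ∈ Finset.range N, S.corr g (u i - u j)
      = ∫ x, (∑ i ∈ Finset.range N, g (S.T (u i) x)) ^ 2 ∂μ := by
    simp only [← S.corr_sub hg, sq, Finset.sum_mul_sum]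
    rw [integral_finsetSum _ fun i _ => integrable_finsetSum _ fun j _ => hint i j]
    exact Finset.sum_congr rfl fun i _ => (integral_finsetSum _ fun j _ => hint i j).symm
  rw [h]
  positivity

variable (ν : Measure (Fin m → ℝ)) [IsProbabilityMeasure ν]

lemma integrable_corr (hg : Measurable g) (hb : ∀ x, |g x| ≤ 1) (t : ℝ) :
    Integrable (fun z : (Fin m → ℝ) × (Fin m → ℝ) => S.corr g (t • (z.1 - z.2)))
      (ν.prod ν) := by
  refine Integrable.of_bound ?_ 1 (ae_of_all _ fun z => S.abs_corr_le_one hb _)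
  refine StronglyMeasurable.aestronglyMeasurable ?_
  unfold corr
  refine StronglyMeasurable.integral_prod_right ?_
  refine Measurable.stronglyMeasurable ?_
  refine (hg.comp (S.measurable_pair.comp (Measurable.prodMk ?_ measurable_snd))).mul
    (hg.comp measurable_snd)
  fun_prop

lemma integral_sq_average (hg : Measurable g) (hb : ∀ x, |g x| ≤ 1) (t : ℝ) :
    ∫ x, (∫ α, g (S.T (t • α) x) ∂ν) ^ 2 ∂μ
      = ∫ z, S.corr g (t • (z.1 - z.2)) ∂(ν.prod ν) := by
  have h : ∀ x, (∫ α, g (S.T (t • α) x) ∂ν) ^ 2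
      = ∫ z, g (S.T (t • z.1) x) * g (S.T (t • z.2) x) ∂(ν.prod ν) := fun x => by
    rw [integral_prod_mul (fun α => g (S.T (t • α) x)) (fun α => g (S.T (t • α) x)), sq]
  simp only [h]
  rw [integral_integral_swap]
  · simp only [smul_sub, S.corr_sub hg]
  · refine Integrable.of_bound ?_ 1 (ae_of_all _ fun z => ?_)
    · have h1 : Measurable fun p : X × ((Fin m → ℝ) × (Fin m → ℝ)) => (p.1, p.2.1) := by fun_prop
      have h2 : Measurable fun p : X × ((Fin m → ℝ) × (Fin m → ℝ)) => (p.1, p.2.2) := by fun_prop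
      exact (((S.measurable_pair_smul hg t).comp h1).mul
        ((S.measurable_pair_smul hg t).comp h2)).aestronglyMeasurable
    · rw [Function.uncurry, norm_mul]
      exact mul_le_one₀ (hb _) (norm_nonneg _) (hb _)

lemma integral_sq_average_neg (hg : Measurable g) (hb : ∀ x, |g x| ≤ 1) (t : ℝ) :
    ∫ x, (∫ α, g (S.T (-t • α) x) ∂ν) ^ 2 ∂μ = ∫ x, (∫ α, g (S.T (t • α) x) ∂ν) ^ 2 ∂μ := by
  rw [S.integral_sq_average ν hg hb (-t), S.integral_sq_average ν hg hb t]
  simp only [neg_smul, S.corr_neg hg]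

lemma integral_sq_average_le_one (hg : Measurable g) (hb : ∀ x, |g x| ≤ 1) (t : ℝ) :
    ∫ x, (∫ α, g (S.T (t • α) x) ∂ν) ^ 2 ∂μ ≤ 1 := by
  rw [S.integral_sq_average ν hg hb]
  have := norm_integral_le_of_norm_le_const (μ := ν.prod ν) (C := 1)
    (f := fun z => S.corr g (t • (z.1 - z.2))) (ae_of_all _ fun z =>
      S.abs_corr_le_one hb _)
  simpa using (le_abs_self _).trans this

/-- Positive definiteness of the correlations gives a lower bound for sums of mean squares along
an arithmetic progression of times. -/
lemma le_sum_integral_sq_average (hg : Measurable g) (hb : ∀ x, |g x| ≤ 1)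
    {E : Set (Fin m → ℝ)} {δ : ℝ}
    (hE : ∀ α ∈ E, ∀ β ∈ E, ∀ t : ℝ, δ ≤ S.corr g (t • (α - β))) (hδ : 0 ≤ δ)
    (N : ℕ) (τ : ℝ) :
    (N : ℝ) ^ 2 * δ * ν.real E ^ 2 ≤ ∑ i ∈ Finset.range N, ∑ j ∈ Finset.range N,
      ∫ x, (∫ α, g (S.T ((i * τ - j * τ : ℝ) • α) x) ∂ν) ^ 2 ∂μ := by
  set F : (Fin m → ℝ) × (Fin m → ℝ) → ℝ := fun z =>
    ∑ i ∈ Finset.range N, ∑ j ∈ Finset.range N, S.corr g ((i * τ - j * τ : ℝ) • (z.1 - z.2))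
  have hint : ∀ i j : ℕ, Integrable (fun z : (Fin m → ℝ) × (Fin m → ℝ) =>
      S.corr g ((i * τ - j * τ : ℝ) • (z.1 - z.2))) (ν.prod ν) :=
    fun i j => S.integrable_corr ν hg hb _
  have hF : Integrable F (ν.prod ν) :=
    integrable_finsetSum _ fun i _ => integrable_finsetSum _ fun j _ => hint i j
  have hF0 : ∀ z, 0 ≤ F z := fun z => by
    have := S.sum_corr_nonneg hg hb N fun i => ((i : ℝ) * τ) • (z.1 - z.2)
    simpa only [← sub_smul] using this
  have hsum : ∫ z, F z ∂(ν.prod ν) = ∑ i ∈ Finset.range N, ∑ j ∈ Finset.range N,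
      ∫ x, (∫ α, g (S.T ((i * τ - j * τ : ℝ) • α) x) ∂ν) ^ 2 ∂μ := by
    simp only [S.integral_sq_average ν hg hb]
    rw [integral_finsetSum _ fun i _ => integrable_finsetSum _ fun j _ => hint i j]
    exact Finset.sum_congr rfl fun i _ => integral_finsetSum _ fun j _ => hint i j
  rw [← hsum]
  refine le_trans ?_ (mul_meas_ge_le_integral_of_nonneg (ae_of_all _ hF0) hF ((N : ℝ) ^ 2 * δ))
  rw [sq (ν.real E), ← measureReal_prod_prod]
  refine mul_le_mul_of_nonneg_left (measureReal_mono ?_) (by positivity)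
  rintro ⟨α, β⟩ ⟨hα, hβ⟩
  have : ∑ _i ∈ Finset.range N, ∑ _j ∈ Finset.range N, δ ≤ F (α, β) :=
    Finset.sum_le_sum fun i _ => Finset.sum_le_sum fun j _ => hE α hα β hβ _
  simpa [sq, mul_assoc] using this

lemma corr_indicator_sub {B : Set X} (hB : MeasurableSet B) (γ : Fin m → ℝ) :
    S.corr (fun x => B.indicator 1 x - μ.real B) γ
      = μ.real B * (1 - μ.real B) - μ.real (symmDiff (S.T γ ⁻¹' B) B) / 2 := by
  set p := μ.real B
  have hB' : MeasurableSet (S.T γ ⁻¹' B) := S.measurable_T γ hB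
  have hD : MeasurableSet (symmDiff (S.T γ ⁻¹' B) B) := hB'.symmDiff hB
  have hI : ∀ {C : Set X}, MeasurableSet C → Integrable (fun x => C.indicator (1 : X → ℝ) x) μ :=
    fun hC => (integrable_const (1 : ℝ)).indicator hC
  have hadd : Integrable (fun x => (1 / 2 - p) *
      ((S.T γ ⁻¹' B).indicator (1 : X → ℝ) x + B.indicator 1 x)) μ :=
    ((hI hB').add (hI hB)).const_mul _
  have key : ∀ x, (B.indicator (1 : X → ℝ) (S.T γ x) - p) * (B.indicator 1 x - p)
      = (1 / 2 - p) * ((S.T γ ⁻¹' B).indicator 1 x + B.indicator 1 x)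
        - 1 / 2 * (symmDiff (S.T γ ⁻¹' B) B).indicator 1 x + p ^ 2 := fun x => by
    by_cases h1 : S.T γ x ∈ B <;> by_cases h2 : x ∈ B <;>
      simp [Set.indicator, h1, h2, Set.mem_symmDiff] <;> ring
  have hp : μ.real (S.T γ ⁻¹' B) = p :=
    (S.measurePreserving γ).measureReal_preimage hB.nullMeasurableSet
  simp only [corr, key]
  rw [integral_add (hadd.sub' ((hI hD).const_mul _)) (integrable_const _),
    integral_sub hadd ((hI hD).const_mul _), integral_const_mul, integral_const_mul,
    integral_add (hI hB') (hI hB), integral_indicator_one hB', integral_indicator_one hB,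
    integral_indicator_one hD, hp, integral_const, probReal_univ, one_smul]
  ring

/-- The directions along which `B` is uniformly almost invariant. -/
def almostInvDirections (B : Set X) : Set (Fin m → ℝ) :=
  {α | ∀ t : ℝ, μ.real (symmDiff (S.T (t • α) ⁻¹' B) B) ≤ μ.real B * (1 - μ.real B) / 2}

lemma le_corr_of_mem_almostInvDirections {B : Set X} (hB : MeasurableSet B)
    {α β : Fin m → ℝ} (hα : α ∈ S.almostInvDirections B) (hβ : β ∈ S.almostInvDirections B)
    (t : ℝ) :
    μ.real B * (1 - μ.real B) / 2
      ≤ S.corr (fun x => B.indicator 1 x - μ.real B) (t • (α - β)) := by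
  rw [S.corr_indicator_sub hB]
  have h1 : S.T (t • (α - β)) ⁻¹' B = S.T (-t • β) ⁻¹' (S.T (t • α) ⁻¹' B) := by
    rw [← Set.preimage_comp, S.T_add]
    congr 2
    module
  have h2 := measureReal_symmDiff_le (μ := μ) (s := S.T (t • (α - β)) ⁻¹' B)
    (t := S.T (-t • β) ⁻¹' B) B
  have h3 : symmDiff (S.T (t • (α - β)) ⁻¹' B) (S.T (-t • β) ⁻¹' B)
      = S.T (-t • β) ⁻¹' (symmDiff (S.T (t • α) ⁻¹' B) B) := by
    rw [h1]; rfl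
  rw [h3, (S.measurePreserving _).measureReal_preimage
    ((S.measurable_T _ hB).symmDiff hB).nullMeasurableSet] at h2
  linarith [hα t, hβ (-t)]

/-- The measure algebra of a system is separable. -/
lemma exists_seq_measureReal_symmDiff_lt (S : RSystem m X μ) :
    ∃ B : ℕ → Set X, (∀ n, MeasurableSet (B n)) ∧
      ∀ C, MeasurableSet C → ∀ ε > 0, ∃ n, μ.real (symmDiff C (B n)) < ε := by
  have := S.separableL2
  let I : {C : Set X // MeasurableSet C} → Lp ℂ 2 μ := fun C =>
    indicatorConstLp 2 C.2 (measure_ne_top μ _) 1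
  have hsep : TopologicalSpace.SeparableSpace (Set.range I) :=
    (TopologicalSpace.IsSeparable.of_separableSpace (Set.range I)).separableSpace
  have : Nonempty (Set.range I) := ⟨⟨I ⟨∅, .empty⟩, Set.mem_range_self _⟩⟩
  have hd := TopologicalSpace.denseRange_denseSeq (Set.range I)
  choose B hB using fun n => (TopologicalSpace.denseSeq (Set.range I) n).2
  refine ⟨fun n => B n, fun n => (B n).2, fun C hC ε hε => ?_⟩
  obtain ⟨n, hn⟩ := hd.exists_dist_lt ⟨I ⟨C, hC⟩, Set.mem_range_self _⟩ (Real.sqrt_pos.2 hε)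
  refine ⟨n, ?_⟩
  rw [Subtype.dist_eq, ← hB n] at hn
  simp only [I] at hn
  rw [dist_indicatorConstLp_eq_norm, norm_indicatorConstLp (by simp) (by simp), norm_one, one_mul,
    ENNReal.toReal_ofNat, ← Real.sqrt_eq_rpow] at hn
  exact (Real.sqrt_lt_sqrt_iff measureReal_nonneg).1 hn

lemma exists_of_mem_W {α : Fin m → ℝ} (hα : α ∈ S.W) :
    ∃ C, MeasurableSet C ∧ (∀ t : ℝ, μ (symmDiff (S.T (t • α) ⁻¹' C) C) = 0) ∧
      0 < μ.real C ∧ μ.real C < 1 := by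
  by_contra! hcon
  refine hα (Set.Subset.antisymm ?_ fun C hC => ⟨hC.1, fun g _ => hC.2 g trivial⟩)
  rintro C ⟨hC, hinv⟩
  refine ⟨hC, fun g _ => ?_⟩
  have hC' := S.measurable_T g hC
  have hmp := (S.measurePreserving g).measure_preimage hC.nullMeasurableSet
  rcases (measureReal_nonneg (μ := μ) (s := C)).eq_or_lt with h0 | h0
  · have h0' : μ C = 0 := (measureReal_eq_zero_iff).1 h0.symm
    refine measure_mono_null symmDiff_le_sup ?_
    exact measure_union_null (hmp.trans h0') h0'
  · have h1 : μ C = 1 := by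
      have := le_antisymm measureReal_le_one
        (hcon C hC (fun t => hinv _ (Set.mem_range_self t)) h0)
      rwa [measureReal_def, ENNReal.toReal_eq_one_iff] at this
    rw [← compl_symmDiff_compl]
    refine measure_mono_null symmDiff_le_sup (measure_union_null ?_ ?_)
    · rw [prob_compl_eq_zero_iff hC', hmp, h1]
    · rw [prob_compl_eq_zero_iff hC, h1]

lemma W_subset_iUnion_almostInvDirections {B : ℕ → Set X} (hB : ∀ n, MeasurableSet (B n))
    (hd : ∀ C, MeasurableSet C → ∀ ε > 0, ∃ n, μ.real (symmDiff C (B n)) < ε) :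
    S.W ⊆ ⋃ n : {n // 0 < μ.real (B n) * (1 - μ.real (B n))}, S.almostInvDirections (B n) := by
  intro α hα
  obtain ⟨C, hC, hinv, h0, h1⟩ := S.exists_of_mem_W hα
  set q := μ.real C
  have hq : 0 < q * (1 - q) := mul_pos h0 (by linarith)
  obtain ⟨n, hn⟩ := hd C hC (q * (1 - q) / 8) (by positivity)
  have hpq := (abs_measureReal_sub_le_measureReal_symmDiff (μ := μ) hC.nullMeasurableSet
    (hB n).nullMeasurableSet).trans hn.le
  set p := μ.real (B n)
  have hp0 : 0 ≤ p := measureReal_nonneg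
  have hp1 : p ≤ 1 := measureReal_le_one
  have hdiff : q * (1 - q) - p * (1 - p) ≤ q * (1 - q) / 8 := by
    have : q * (1 - q) - p * (1 - p) = (q - p) * (1 - q - p) := by ring
    rw [this]
    refine (le_abs_self _).trans ?_
    rw [abs_mul]
    refine (mul_le_of_le_one_right (abs_nonneg _) ?_).trans hpq
    rw [abs_le]
    constructor <;> linarith
  refine Set.mem_iUnion.2 ⟨⟨n, by linarith⟩, fun t => ?_⟩
  have h2 := measureReal_symmDiff_le (μ := μ) (s := S.T (t • α) ⁻¹' B n)
    (t := S.T (t • α) ⁻¹' C) (B n)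
  have h3 := measureReal_symmDiff_le (μ := μ) (s := S.T (t • α) ⁻¹' C) (t := C) (B n)
  have h4 : μ.real (symmDiff (S.T (t • α) ⁻¹' B n) (S.T (t • α) ⁻¹' C))
      = μ.real (symmDiff C (B n)) := by
    rw [symmDiff_comm C]
    exact (S.measurePreserving _).measureReal_preimage ((hB n).symmDiff hC).nullMeasurableSet
  have h5 : μ.real (symmDiff (S.T (t • α) ⁻¹' C) C) = 0 := by simp [measureReal_def, hinv t]
  change _ ≤ p * (1 - p) / 2
  linarith

lemma WeaklyEquidistributed.tendsto_integral_sq_average {S : RSystem m X μ}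
    {ν : Measure (Fin m → ℝ)} [IsProbabilityMeasure ν] (h : S.WeaklyEquidistributed ν) :
    ∃ A : Set ℝ, MeasurableSet A ∧ HasDensityOne A ∧
      ∀ g : X → ℝ, Measurable g → (∀ x, |g x| ≤ 1) → ∫ x, g x ∂μ = 0 →
        Tendsto (fun t : ℝ => ∫ x, (∫ α, g (S.T (t • α) x) ∂ν) ^ 2 ∂μ)
          (atTop ⊓ Filter.principal A) (𝓝 0) := by
  obtain ⟨A, hA, hA1, hconv⟩ := h
  refine ⟨A, hA, hA1, fun g hg hb h0 => ?_⟩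
  rw [← integral_zero X ℝ (μ := μ)]
  refine tendsto_integral_filter_of_dominated_convergence (fun _ => 1) ?_ ?_
    (integrable_const _) ?_
  · refine Eventually.of_forall fun t => ?_
    have : StronglyMeasurable fun x => ∫ α, g (S.T (t • α) x) ∂ν :=
      (S.measurable_pair_smul hg t).stronglyMeasurable.integral_prod_right'
    exact (this.measurable.pow_const 2).aestronglyMeasurable
  · refine Eventually.of_forall fun t => ae_of_all _ fun x => ?_
    have := norm_integral_le_of_norm_le_const (μ := ν) (C := 1)
      (f := fun α => g (S.T (t • α) x)) (ae_of_all _ fun α => hb (S.T (t • α) x))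
    rw [norm_pow]
    exact pow_le_one₀ (norm_nonneg _) (by simpa using this)
  · have := hconv (fun x => (g x : ℂ)) (by fun_prop) ⟨1, fun x => by simpa using hb x⟩
    filter_upwards [this] with x hx
    have hx' := (hx.norm).pow 2
    simpa [integral_complex_ofReal, h0] using hx'

end Lemmas

end RSystem

/-- A set of density one contains the first `N` multiples of arbitrarily large numbers. -/
lemma HasDensityOne.exists_forall_mul_mem {A : Set ℝ} (hA : MeasurableSet A)
    (h : HasDensityOne A) (N : ℕ) (R : ℝ) :
    ∃ τ, R ≤ τ ∧ ∀ k ∈ Finset.Icc 1 N, (k : ℝ) * τ ∈ A := by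
  by_contra! hcon
  set η : ℝ := 1 / (2 * (N + 1))
  have hη : 0 < η := by positivity
  obtain ⟨T₀, hT₀⟩ := eventually_atTop.1 (h.eventually (lt_mem_nhds (sub_lt_self 1 hη)))
  set D : ℝ → Set ℝ := fun T => Set.Icc 0 T \ A
  have hfin : ∀ T, volume (D T) ≠ ⊤ := fun T =>
    measure_ne_top_of_subset Set.sdiff_subset (by simp)
  have hD : ∀ T, T₀ ≤ T → 0 < T → volume.real (D T) ≤ η * T := by
    intro T hT hpos
    have h1 := hT₀ T hT
    rw [← measureReal_def, lt_div_iff₀ hpos] at h1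
    have h2 := measureReal_inter_add_sdiff (μ := volume) (s := Set.Icc 0 T) hA (by simp)
    rw [Real.volume_real_Icc_of_le hpos.le, Set.inter_comm] at h2
    change volume.real (Set.Icc 0 T \ A) ≤ _
    linarith
  set R' := max R 0
  set T := max (2 * R' + 1) T₀
  have hR0 : 0 ≤ R' := le_max_right _ _
  have hTR : 2 * R' + 1 ≤ T := le_max_left _ _
  have hT0 : T₀ ≤ T := le_max_right _ _
  have hsub : Set.Icc R' T ⊆ ⋃ k ∈ Finset.Icc 1 N, (fun τ : ℝ => (k : ℝ) * τ) ⁻¹' D (k * T) := by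
    intro τ hτ
    obtain ⟨k, hk, hkA⟩ := hcon τ ((le_max_left _ _).trans hτ.1)
    have hτ0 : 0 ≤ τ := hR0.trans hτ.1
    refine Set.mem_biUnion hk ⟨⟨by positivity, ?_⟩, hkA⟩
    exact mul_le_mul_of_nonneg_left hτ.2 (by positivity)
  have hpre : ∀ k ∈ Finset.Icc 1 N,
      volume ((fun τ : ℝ => (k : ℝ) * τ) ⁻¹' D (k * T)) ≤ ENNReal.ofReal (η * T) := by
    intro k hk
    have hk1 : (1 : ℝ) ≤ k := by exact_mod_cast (Finset.mem_Icc.1 hk).1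
    have hkpos : (0 : ℝ) < k := by linarith
    have hTpos : 0 < T := by linarith
    have hle : T ≤ k * T := le_mul_of_one_le_left hTpos.le hk1
    rw [Real.volume_preimage_mul_left hkpos.ne', ← ofReal_measureReal (hfin _),
      ← ENNReal.ofReal_mul (abs_nonneg _)]
    refine ENNReal.ofReal_le_ofReal ?_
    rw [abs_of_pos (inv_pos.2 hkpos), inv_mul_le_iff₀ hkpos]
    calc _ ≤ η * (k * T) := hD _ (hT0.trans hle) (by linarith)
      _ = _ := by ring
  have hvol := (measure_mono hsub).trans ((measure_biUnion_finset_le (μ := volume) _ _).trans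
    (Finset.sum_le_sum hpre))
  rw [Real.volume_Icc, Finset.sum_const, Nat.card_Icc, Nat.add_sub_cancel, nsmul_eq_mul,
    ← ENNReal.ofReal_natCast, ← ENNReal.ofReal_mul (by positivity),
    ENNReal.ofReal_le_ofReal_iff (by have : 0 < T := by linarith
                                     positivity)] at hvol
  have hNη : (N : ℝ) * η ≤ 1 / 2 := by
    simp only [η]
    rw [mul_one_div, div_le_div_iff₀ (by positivity) (by norm_num)]
    linarith
  have : (N : ℝ) * (η * T) ≤ 1 / 2 * T := by
    rw [← mul_assoc]
    exact mul_le_mul_of_nonneg_right hNη (by linarith)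
  linarith

/-- If `X` is an ergodic `ℝ^m`-system and `ν(W(X) + β) > 0` for some
`β ∈ ℝ^m`, then `ν` is not weakly equidistributed for `X`. -/
theorem not_weakly_equidistributed_of_pos_translate_of_W
    (m : ℕ) (ν : Measure (Fin m → ℝ)) [IsProbabilityMeasure ν]
    (X : Type) [MeasurableSpace X] (μ : Measure X) [IsProbabilityMeasure μ]
    (S : RSystem m X μ) (hS : S.IsErgodic)
    (hν : ∃ β : Fin m → ℝ, 0 < ν ((fun α => α + β) '' S.W)) :
    ¬ S.WeaklyEquidistributed ν := by
  intro hwe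
  obtain ⟨β, hβ⟩ := hν
  obtain ⟨B, hB, hd⟩ := S.exists_seq_measureReal_symmDiff_lt
  obtain ⟨⟨n, hn⟩, hpos⟩ : ∃ n : {n // 0 < μ.real (B n) * (1 - μ.real (B n))},
      0 < ν ((fun α => α + β) '' S.almostInvDirections (B n)) := by
    by_contra! hcon
    refine hβ.ne' (measure_mono_null
      (Set.image_mono (S.W_subset_iUnion_almostInvDirections hB hd)) ?_)
    rw [Set.image_iUnion]
    exact measure_iUnion_null fun n => nonpos_iff_eq_zero.1 (hcon n)
  set p := μ.real (B n)
  set E := (fun α => α + β) '' S.almostInvDirections (B n)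
  have hc : 0 < ν.real E := ENNReal.toReal_pos hpos.ne' (measure_ne_top _ _)
  set c := ν.real E
  set g : X → ℝ := fun x => (B n).indicator 1 x - p
  have hg : Measurable g := (measurable_one.indicator (hB n)).sub_const _
  have hp0 : 0 ≤ p := measureReal_nonneg
  have hp1 : p ≤ 1 := measureReal_le_one
  have hb : ∀ x, |g x| ≤ 1 := fun x => by
    by_cases hx : x ∈ B n <;> simp only [g, Set.indicator, hx, if_true, if_false, Pi.one_apply] <;>
      rw [abs_le] <;> constructor <;> linarith
  have hg0 : ∫ x, g x ∂μ = 0 := by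
    simp only [g]
    have hI : Integrable (fun x => (B n).indicator (1 : X → ℝ) x) μ :=
      (integrable_const (1 : ℝ)).indicator (hB n)
    rw [integral_sub hI (integrable_const _),
      integral_indicator_one (hB n)]
    simp [p]
  set δ := p * (1 - p) / 2
  have hδ : 0 < δ := by positivity
  have hE : ∀ α ∈ E, ∀ α' ∈ E, ∀ t : ℝ, δ ≤ S.corr g (t • (α - α')) := by
    rintro _ ⟨α, hα, rfl⟩ _ ⟨α', hα', rfl⟩ t
    rw [add_sub_add_right_eq_sub]
    exact S.le_corr_of_mem_almostInvDirections (hB n) hα hα' t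
  obtain ⟨A, hA, hA1, hconv⟩ := hwe.tendsto_integral_sq_average
  set Φ : ℝ → ℝ := fun t => ∫ x, (∫ α, g (S.T (t • α) x) ∂ν) ^ 2 ∂μ
  set ε := δ * c ^ 2 / 4
  have hε : 0 < ε := by positivity
  obtain ⟨R, hR⟩ := eventually_atTop.1 (eventually_inf_principal.1
    ((hconv g hg hb hg0).eventually (gt_mem_nhds hε)))
  obtain ⟨N, hN⟩ := exists_nat_gt (1 / ε)
  rw [div_lt_iff₀ hε] at hN
  obtain ⟨τ, hτ, hτA⟩ := hA1.exists_forall_mul_mem hA N (max R 0)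
  have hlt : ∀ i j : ℕ, i < N → j < i → Φ (i * τ - j * τ) ≤ ε := by
    intro i j hi hji
    have hk : (1 : ℝ) ≤ ((i - j : ℕ) : ℝ) := by exact_mod_cast (by omega : 1 ≤ i - j)
    have h1 := hτA (i - j) (Finset.mem_Icc.2 ⟨by omega, by omega⟩)
    have hτ0 : 0 ≤ τ := (le_max_right _ _).trans hτ
    have h2 : R ≤ ((i - j : ℕ) : ℝ) * τ :=
      ((le_max_left _ _).trans hτ).trans (le_mul_of_one_le_left hτ0 hk)
    rw [← sub_mul, ← Nat.cast_sub hji.le]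
    exact (hR _ h2 h1).le
  have hle : ∀ i ∈ Finset.range N, ∀ j ∈ Finset.range N,
      Φ (i * τ - j * τ) ≤ (if i = j then 1 else 0) + ε := by
    intro i hi j hj
    rw [Finset.mem_range] at hi hj
    rcases lt_trichotomy j i with hji | rfl | hij
    · simpa [hji.ne'] using hlt i j hi hji
    · have := S.integral_sq_average_le_one ν hg hb (j * τ - j * τ)
      simp only [if_true]
      linarith
    · have h1 : Φ (i * τ - j * τ) = Φ (j * τ - i * τ) := by
        rw [← neg_sub]
        exact S.integral_sq_average_neg ν hg hb _
      rw [h1]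
      simpa [hij.ne] using hlt j i hj hij
  have hlow := S.le_sum_integral_sq_average ν hg hb hE hδ.le N τ
  have hup := Finset.sum_le_sum fun i hi => Finset.sum_le_sum (hle i hi)
  have hval : ∑ i ∈ Finset.range N, ∑ j ∈ Finset.range N, ((if i = j then (1 : ℝ) else 0) + ε)
      = N + N ^ 2 * ε := by
    have : ∀ i ∈ Finset.range N, ∑ j ∈ Finset.range N, ((if i = j then (1 : ℝ) else 0) + ε)
        = 1 + N * ε := fun i hi => by
      rw [Finset.sum_add_distrib, Finset.sum_ite_eq, if_pos hi]
      simp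
    rw [Finset.sum_congr rfl this]
    simp
    ring
  rw [hval] at hup
  have h4 : (N : ℝ) ^ 2 * δ * c ^ 2 = 4 * (N ^ 2 * ε) := by
    simp only [ε]; ring
  have hNpos : (0 : ℝ) < N := pos_of_mul_pos_left (one_pos.trans hN) hε.le
  have h5 : (N : ℝ) < N ^ 2 * ε := by
    nlinarith
  have h6 := hlow.trans hup
  rw [h4] at h6
  linarith
end

section
/- Let X = (X, 𝒳, μ, (T_t)_{t∈ℝ}) be an ergodic ℝ-system which is nontrivial, i.e. there exists a measurable set B with 0 < μ(B) < 1. If a Borel probability measure ν on ℝ satisfies ν({β}) > 0 for some β ∈ ℝ, then ν is not weakly equidistributed for X. -/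
open MeasureTheory Filter Topology

theorem HasDensityOne.exists_mem_ge {A : Set ℝ} (hA : HasDensityOne A) (M : ℝ) :
    ∃ t ∈ A, M ≤ t := by
  by_contra! h
  have hlim : Tendsto (fun T' : ℝ => (volume (Set.Icc 0 M)).toReal / T') atTop (𝓝 0) :=
    tendsto_const_nhds.div_atTop tendsto_id
  have hle : (1 : ℝ) ≤ 0 := by
    refine le_of_tendsto_of_tendsto hA hlim ?_
    filter_upwards [eventually_ge_atTop (0 : ℝ)] with T' hT'
    refine div_le_div_of_nonneg_right ?_ hT'
    refine ENNReal.toReal_mono isCompact_Icc.measure_lt_top.ne (measure_mono ?_)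
    exact fun t ht => ⟨ht.2.1, (h t ht.1).le⟩
  linarith

/-- If all nonnull measurable sets have measure at least `c > 0`, then every nonnull measurable set
contains an atom. -/
theorem exists_atom_subset {X : Type*} [MeasurableSpace X] {μ : Measure X} [IsFiniteMeasure μ]
    {c : ENNReal} (hc : 0 < c) (h : ∀ E, MeasurableSet E → μ E ≠ 0 → c ≤ μ E)
    {B : Set X} (hB : MeasurableSet B) (hB0 : μ B ≠ 0) :
    ∃ P ⊆ B, MeasurableSet P ∧ μ P ≠ 0 ∧
      ∀ Q, MeasurableSet Q → μ (P ∩ Q) ≠ 0 → μ (P \ Q) = 0 := by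
  let F : Set ENNReal := {r | ∃ P ⊆ B, MeasurableSet P ∧ μ P ≠ 0 ∧ μ P = r}
  have hBF : μ B ∈ F := ⟨B, subset_rfl, hB, hB0, rfl⟩
  have hinf : sInf F ≠ ⊤ := ((sInf_le hBF).trans_lt (measure_lt_top μ B)).ne
  obtain ⟨_, ⟨P, hPB, hP, hP0, rfl⟩, hlt⟩ :=
    sInf_lt_iff.1 (ENNReal.lt_add_right hinf hc.ne')
  refine ⟨P, hPB, hP, hP0, fun Q hQ hPQ => ?_⟩
  by_contra hdiff
  have h1 : sInf F ≤ μ (P ∩ Q) :=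
    sInf_le ⟨P ∩ Q, Set.inter_subset_left.trans hPB, hP.inter hQ, hPQ, rfl⟩
  have h2 := h (P \ Q) (hP.diff hQ) hdiff
  rw [← measure_inter_add_sdiff P hQ] at hlt
  exact absurd (add_le_add h1 h2) hlt.not_ge

/-- A measure preserving map of a probability space returns a set of measure more than `1 / n`
to itself, up to a nonnull set, in fewer than `n` steps. -/
theorem exists_measure_inter_preimage_iterate_ne_zero {X : Type*} [MeasurableSpace X]
    {μ : Measure X} [IsFiniteMeasure μ] {f : X → X} (hf : MeasurePreserving f μ μ)
    {P : Set X} (hP : MeasurableSet P) {n : ℕ} (hn : μ Set.univ < n * μ P) :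
    ∃ k ∈ Set.Ioo 0 n, μ (P ∩ f^[k] ⁻¹' P) ≠ 0 := by
  by_contra! h
  set N : Set X := ⋃ k ∈ Set.Ioo 0 n, P ∩ f^[k] ⁻¹' P
  have hNm : MeasurableSet N := by
    refine MeasurableSet.biUnion (Set.to_countable _) fun k _ => ?_
    exact hP.inter ((hf.iterate k).measurable hP)
  have hN0 : μ N = 0 := (measure_biUnion_null_iff (Set.to_countable _)).2 h
  have hPN : μ (P \ N) = μ P := measure_sdiff_null hN0
  obtain ⟨x, hx, k, hk, hxk⟩ := hf.exists_mem_iterate_mem_of_measure_univ_lt_mul_measure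
    (hP.diff hNm).nullMeasurableSet (n := n) (by rwa [hPN])
  exact hx.2 (Set.mem_biUnion hk ⟨hx.1, hxk.1⟩)

namespace RSystem

variable {m : ℕ} {X : Type*} [MeasurableSpace X] {μ : Measure X}

theorem iterate_T (S : RSystem m X μ) (α : Fin m → ℝ) (k : ℕ) :
    (S.T α)^[k] = S.T ((k : ℝ) • α) := by
  induction k with
  | zero => simp [S.T_zero]
  | succ k ih =>
    rw [Function.iterate_succ, ih, S.T_add]
    congr 1
    push_cast
    module

/-- Atoms are invariant, because `ℝ^m` has no proper subgroups of finite index. -/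
theorem preimage_atom_ae_eq [IsFiniteMeasure μ] (S : RSystem m X μ) {P : Set X}
    (hP : MeasurableSet P) (hP0 : μ P ≠ 0)
    (hatom : ∀ Q, MeasurableSet Q → μ (P ∩ Q) ≠ 0 → μ (P \ Q) = 0) (α : Fin m → ℝ) :
    S.T α ⁻¹' P =ᵐ[μ] P := by
  obtain ⟨n, hn⟩ := ENNReal.exists_nat_mul_gt hP0 (measure_ne_top μ Set.univ)
  set γ : Fin m → ℝ := ((n.factorial : ℝ)⁻¹) • α with hγ
  obtain ⟨k, hk, hk0⟩ :=
    exists_measure_inter_preimage_iterate_ne_zero (S.measurePreserving γ) hP hn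
  have hmp := (S.measurePreserving γ).iterate k
  have hpre : MeasurableSet ((S.T γ)^[k] ⁻¹' P) := hmp.measurable hP
  have hreturn : (S.T γ)^[k] ⁻¹' P =ᵐ[μ] P := by
    refine (ae_eq_of_ae_subset_of_measure_ge ?_ ?_ hP.nullMeasurableSet ?_).symm
    · exact ae_le_set.2 (hatom _ hpre hk0)
    · exact (hmp.measure_preimage hP.nullMeasurableSet).le
    · exact measure_ne_top _ _
  obtain ⟨l, hl⟩ := Nat.dvd_factorial hk.1 hk.2.le
  have h := hmp.quasiMeasurePreserving.preimage_iterate_ae_eq l hreturn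
  rw [← Function.iterate_mul, ← hl, S.iterate_T, hγ, smul_inv_smul₀] at h
  · exact h
  · exact_mod_cast n.factorial_ne_zero

theorem IsErgodic.exists_measure_lt [IsFiniteMeasure μ] {S : RSystem m X μ} (hS : S.IsErgodic)
    {B : Set X} (hB : MeasurableSet B) (hB0 : 0 < μ B) (hB1 : μ B < 1)
    {c : ENNReal} (hc : 0 < c) : ∃ E, MeasurableSet E ∧ μ E ≠ 0 ∧ μ E < c := by
  by_contra! h
  obtain ⟨P, hPB, hP, hP0, hatom⟩ := exists_atom_subset hc h hB hB0.ne'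
  rcases hS P hP fun α => measure_symmDiff_eq_zero_iff.2
    (S.preimage_atom_ae_eq hP hP0 hatom α) with h0 | h1
  · exact hP0 h0
  · exact ((measure_mono hPB).trans_lt hB1).ne h1

end RSystem

/-- A sequence of measurable sets whose measures are equal and nonzero cannot eventually
leave almost every point. -/
theorem not_ae_eventually_notMem {X : Type*} [MeasurableSpace X] {μ : Measure X}
    [IsFiniteMeasure μ] {E : ℕ → Set X} (hE : ∀ n, MeasurableSet (E n)) {r : ENNReal}
    (hr : r ≠ 0) (hμ : ∀ n, μ (E n) = r) : ¬ ∀ᵐ x ∂μ, ∀ᶠ n in atTop, x ∉ E n := by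
  intro h
  have hlim := tendsto_measure_of_ae_tendsto_indicator_of_isFiniteMeasure (μ := μ) atTop
    MeasurableSet.empty hE (by simpa using h)
  simp only [hμ, measure_empty] at hlim
  exact hr (tendsto_nhds_unique tendsto_const_nhds hlim)

/-- If an ergodic `ℝ`-system is nontrivial and `ν({β}) > 0` for some
`β ∈ ℝ`, then `ν` is not weakly equidistributed for the system. -/
theorem not_weakly_equidistributed_of_atom
    (X : Type) [MeasurableSpace X] (μ : Measure X) [IsProbabilityMeasure μ]
    (S : RSystem 1 X μ) (hS : S.IsErgodic)
    (hnontriv : ∃ B : Set X, MeasurableSet B ∧ 0 < μ B ∧ μ B < 1)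
    (ν : Measure (Fin 1 → ℝ)) [IsProbabilityMeasure ν]
    (hν : ∃ β : Fin 1 → ℝ, 0 < ν {β}) :
    ¬ S.WeaklyEquidistributed ν := by
  obtain ⟨B, hB, hB0, hB1⟩ := hnontriv
  obtain ⟨β, hβ⟩ := hν
  rintro ⟨A, -, hA, hconv⟩
  obtain ⟨E, hE, hE0, hEβ⟩ := hS.exists_measure_lt hB hB0 hB1 hβ
  choose t htA ht using fun n : ℕ => hA.exists_mem_ge n
  have htend : Tendsto t atTop (atTop ⊓ 𝓟 A) :=
    tendsto_inf.2 ⟨tendsto_atTop_mono ht tendsto_natCast_atTop_atTop,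
      tendsto_principal.2 (Eventually.of_forall htA)⟩
  refine not_ae_eventually_notMem (μ := μ) (E := fun n => S.T (t n • β) ⁻¹' E)
    (fun n => (S.measurePreserving _).measurable hE) hE0
    (fun n => (S.measurePreserving _).measure_preimage hE.nullMeasurableSet) ?_
  filter_upwards [hconv (E.indicator 1) (measurable_one.indicator hE)
    ⟨1, fun x => by by_cases hx : x ∈ E <;> simp [hx]⟩] with x hx
  have hpre (s : ℝ) : MeasurableSet {α : Fin 1 → ℝ | S.T (s • α) x ∈ E} := by
    have hmeas : Measurable fun α : Fin 1 → ℝ => S.T (s • α) x :=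
      S.measurable_pair.comp ((measurable_const_smul s).prodMk measurable_const)
    exact hmeas hE
  have hint (s : ℝ) : ∫ α, E.indicator (1 : X → ℂ) (S.T (s • α) x) ∂ν =
      (ν.real {α | S.T (s • α) x ∈ E} : ℂ) := by
    have := integral_indicator_one (μ := ν) (hpre s)
    rw [← this, ← integral_complex_ofReal]
    refine integral_congr_ae (Eventually.of_forall fun α => ?_)
    by_cases hα : S.T (s • α) x ∈ E <;> simp [Set.indicator, hα]
  have hintμ : ∫ y, E.indicator (1 : X → ℂ) y ∂μ = (μ.real E : ℂ) := by
    rw [integral_indicator hE]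
    simp
  simp only [hint, hintμ] at hx
  have hreal := (Complex.continuous_re.tendsto _).comp (hx.comp htend)
  have hlt : μ.real E < ν.real {β} :=
    (ENNReal.toReal_lt_toReal (measure_ne_top _ _) (measure_ne_top _ _)).2 hEβ
  filter_upwards [hreal.eventually_lt_const (u := ν.real {β}) (by simpa using hlt)] with n hn hmem
  refine absurd hn (not_lt.2 ?_)
  simp only [Function.comp_apply, Complex.ofReal_re]
  exact measureReal_mono (Set.singleton_subset_iff.2 hmem)
end

section
/- Let m ∈ ℕ and let X be an ℝ^m-system (not necessarily ergodic). Then there exists an at most countable family (V_j)_{j∈J} of proper linear subspaces of ℝ^m such that W(X) = ⋃_{j∈J} V_j. -/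
open MeasureTheory Filter Topology

section FixedVectors

variable {M E : Type*} [NormedAddCommGroup E] [InnerProductSpace ℂ E]

/-- The vectors fixed by all the isometries `U a`, `a ∈ s`. -/
def fixedVectors (U : M → E →ₗᵢ[ℂ] E) (s : Set M) : Submodule ℂ E where
  carrier := {x | ∀ a ∈ s, U a x = x}
  add_mem' hx hy a ha := by rw [map_add, hx a ha, hy a ha]
  zero_mem' a _ := map_zero (U a)
  smul_mem' c x hx a ha := by rw [map_smul, hx a ha]

theorem mem_fixedVectors {U : M → E →ₗᵢ[ℂ] E} {s : Set M} {x : E} :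
    x ∈ fixedVectors U s ↔ ∀ a ∈ s, U a x = x := Iff.rfl

theorem fixedVectors_anti (U : M → E →ₗᵢ[ℂ] E) {s t : Set M} (h : s ⊆ t) :
    fixedVectors U t ≤ fixedVectors U s :=
  fun _ hx a ha => hx a (h ha)

theorem isClosed_fixedVectors (U : M → E →ₗᵢ[ℂ] E) (s : Set M) :
    IsClosed (fixedVectors U s : Set E) := by
  have : (fixedVectors U s : Set E) = ⋂ a ∈ s, {x | U a x = x} := by
    ext x
    simp [mem_fixedVectors]
  rw [this]
  exact isClosed_biInter fun a _ => isClosed_eq (U a).continuous continuous_id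

instance [CompleteSpace E] (U : M → E →ₗᵢ[ℂ] E) (s : Set M) :
    (fixedVectors U s).HasOrthogonalProjection :=
  haveI : CompleteSpace (fixedVectors U s) := (isClosed_fixedVectors U s).completeSpace_coe
  inferInstance

variable [AddCommGroup M]

/-- The projection onto the vectors fixed by `s` preserves the vectors fixed by `b`. -/
theorem map_starProjection_fixedVectors [CompleteSpace E] {U : M → E →ₗᵢ[ℂ] E}
    (U_zero : ∀ x, U 0 x = x) (U_add : ∀ a b x, U (a + b) x = U a (U b x))
    (s : Set M) {b : M} {x : E} (hx : U b x = x) :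
    U b ((fixedVectors U s).starProjection x) = (fixedVectors U s).starProjection x := by
  have comm : ∀ a c y, U a (U c y) = U c (U a y) := fun a c y => by
    rw [← U_add, add_comm, U_add]
  have inv : ∀ (c : M) {y : E}, y ∈ fixedVectors U s → U c y ∈ fixedVectors U s :=
    fun c y hy a ha => by rw [comm, hy a ha]
  refine (Submodule.eq_starProjection_of_mem_of_inner_eq_zero
    (inv b (Submodule.starProjection_apply_mem _ x)) fun w hw => ?_).symm
  have hw' : U b (U (-b) w) = w := by rw [← U_add, add_neg_cancel, U_zero]
  rw [← hw']
  nth_rewrite 1 [← hx]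
  rw [← map_sub, LinearIsometry.inner_map_map]
  exact Submodule.starProjection_inner_eq_zero x _ (inv (-b) hw)

/-- Nonzero pairwise orthogonal vectors of a separable space form a countable family. -/
theorem countable_of_pairwise_inner_eq_zero [TopologicalSpace.SeparableSpace E] {ι : Type*}
    {v : ι → E} (hv : ∀ i, v i ≠ 0) (h : Pairwise fun i j => inner ℂ (v i) (v j) = 0) :
    Countable ι := by
  refine Pairwise.countable_of_isOpen_disjoint (s := fun i => Metric.ball (v i) (‖v i‖ / 2))
    (fun i j hij => ?_) (fun i => Metric.isOpen_ball)
    (fun i => ⟨v i, Metric.mem_ball_self (half_pos (norm_pos_iff.2 (hv i)))⟩)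
  refine Metric.ball_disjoint_ball ?_
  have hpyth : ‖v i - v j‖ ^ 2 = ‖v i‖ ^ 2 + ‖v j‖ ^ 2 := by
    simp [norm_sub_sq (𝕜 := ℂ), h hij]
  rw [dist_eq_norm]
  nlinarith [sq_nonneg (‖v i‖ - ‖v j‖), norm_nonneg (v i), norm_nonneg (v j),
    norm_nonneg (v i - v j)]

variable {R : Type*} [Ring R] [Module R M]

/-- Only countably many subspaces of `M` are maximal among those having a fixed vector which is not
fixed by all of `M`. -/
theorem countable_maximal_fixedVectors_ne [CompleteSpace E] [TopologicalSpace.SeparableSpace E]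
    {U : M → E →ₗᵢ[ℂ] E}
    (U_zero : ∀ x, U 0 x = x) (U_add : ∀ a b x, U (a + b) x = U a (U b x)) :
    {V : Submodule R M |
      Maximal (fun V : Submodule R M => fixedVectors U V ≠ fixedVectors U Set.univ) V}.Countable := by
  set F := fixedVectors U Set.univ with hF
  have exists_vec : ∀ V : {V : Submodule R M | Maximal (fun V : Submodule R M =>
      fixedVectors U V ≠ F) V}, ∃ x ∈ fixedVectors U (V : Submodule R M), x ∈ Fᗮ ∧ x ≠ 0 := by
    rintro ⟨V, hV⟩
    have hle : F ≤ fixedVectors U V := fixedVectors_anti U (Set.subset_univ _)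
    obtain ⟨y, hyV, hyF⟩ := SetLike.exists_of_lt (lt_of_le_of_ne hle (Set.mem_ofPred.1 hV).prop.symm)
    refine ⟨y - F.starProjection y,
      sub_mem hyV (hle (Submodule.starProjection_apply_mem _ y)),
      Submodule.sub_starProjection_mem_orthogonal y, fun h0 => hyF ?_⟩
    rw [sub_eq_zero.1 h0]
    exact Submodule.starProjection_apply_mem _ y
  choose v hvV hvF hv0 using exists_vec
  refine countable_of_pairwise_inner_eq_zero hv0 fun V V' hne => ?_
  have hsup : fixedVectors U ((V : Submodule R M) ⊔ V' : Submodule R M) = F := by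
    by_contra hcon
    have h1 := (Set.mem_ofPred.1 V.2).eq_of_le hcon le_sup_left
    have h2 := (Set.mem_ofPred.1 V'.2).eq_of_le hcon le_sup_right
    exact hne (Subtype.ext (h1.trans h2.symm))
  set P := (fixedVectors U (V : Submodule R M)).starProjection
  have hPF : P (v V') ∈ F := by
    rw [← hsup]
    intro a ha
    obtain ⟨b, hb, c, hc, rfl⟩ := Submodule.mem_sup.1 ha
    rw [U_add, map_starProjection_fixedVectors U_zero U_add _ (hvV V' c hc)]
    exact Submodule.starProjection_apply_mem (fixedVectors U (V : Submodule R M)) (v V') b hb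
  have hsub : inner ℂ (v V) (v V' - P (v V')) = 0 :=
    (Submodule.sub_starProjection_mem_orthogonal (v V')) _ (hvV V)
  rw [inner_sub_right, Submodule.inner_left_of_mem_orthogonal hPF (hvF V), sub_zero] at hsub
  exact hsub

end FixedVectors

namespace RSystem

variable {m : ℕ} {X : Type*} [MeasurableSpace X] {μ : Measure X}

/-- The Koopman representation on `L²(μ)`. -/
noncomputable def koopman (S : RSystem m X μ) (α : Fin m → ℝ) : Lp ℂ 2 μ →ₗᵢ[ℂ] Lp ℂ 2 μ :=
  Lp.compMeasurePreservingₗᵢ ℂ (S.T α) (S.measurePreserving α)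

theorem coeFn_koopman (S : RSystem m X μ) (α : Fin m → ℝ) (f : Lp ℂ 2 μ) :
    S.koopman α f =ᵐ[μ] f ∘ S.T α :=
  Lp.coeFn_compMeasurePreserving f (S.measurePreserving α)

theorem koopman_eq_self_iff (S : RSystem m X μ) (α : Fin m → ℝ) (f : Lp ℂ 2 μ) :
    S.koopman α f = f ↔ f ∘ S.T α =ᵐ[μ] f := by
  rw [Lp.ext_iff]
  exact ⟨(S.coeFn_koopman α f).symm.trans, (S.coeFn_koopman α f).trans⟩

theorem koopman_zero (S : RSystem m X μ) (f : Lp ℂ 2 μ) : S.koopman 0 f = f := by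
  rw [koopman_eq_self_iff, S.T_zero]
  rfl

theorem koopman_add (S : RSystem m X μ) (α β : Fin m → ℝ) (f : Lp ℂ 2 μ) :
    S.koopman (α + β) f = S.koopman α (S.koopman β f) := by
  refine Lp.ext ?_
  have h : S.koopman β f ∘ S.T α =ᵐ[μ] (f ∘ S.T β) ∘ S.T α :=
    (S.measurePreserving α).quasiMeasurePreserving.ae_eq_comp (S.coeFn_koopman β f)
  rw [Function.comp_assoc, S.T_add, add_comm] at h
  exact (S.coeFn_koopman _ f).trans (h.symm.trans (S.coeFn_koopman α _).symm)

theorem invSets_anti (S : RSystem m X μ) {H K : Set (Fin m → ℝ)} (h : H ⊆ K) :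
    S.InvSets K ⊆ S.InvSets H :=
  fun _ hA => ⟨hA.1, fun g hg => hA.2 g (h hg)⟩

theorem indicatorConstLp_mem_fixedVectors_iff [IsFiniteMeasure μ] (S : RSystem m X μ)
    (H : Set (Fin m → ℝ)) {A : Set X} (hA : MeasurableSet A) :
    indicatorConstLp 2 hA (measure_ne_top μ A) (1 : ℂ) ∈ fixedVectors S.koopman H ↔
      A ∈ S.InvSets H := by
  have key : ∀ g, S.koopman g (indicatorConstLp 2 hA (measure_ne_top μ A) (1 : ℂ)) =
      indicatorConstLp 2 hA (measure_ne_top μ A) (1 : ℂ) ↔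
        μ (symmDiff (S.T g ⁻¹' A) A) = 0 := fun g => by
    rw [measure_symmDiff_eq_zero_iff]
    have : S.koopman g (indicatorConstLp 2 hA (measure_ne_top μ A) (1 : ℂ)) =
        indicatorConstLp 2 ((S.measurePreserving g).measurable hA) (measure_ne_top μ _) 1 :=
      Lp.indicatorConstLp_compMeasurePreserving hA (measure_ne_top μ A) 1 (S.measurePreserving g)
    rw [this, indicatorConstLp_inj _ _ _ _ one_ne_zero]
  simp only [mem_fixedVectors, key, InvSets, Set.mem_ofPred_eq, hA, true_and]

theorem preimage_mem_invSets (S : RSystem m X μ) {H : Set (Fin m → ℝ)} {f : Lp ℂ 2 μ}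
    (hf : f ∈ fixedVectors S.koopman H) {B : Set ℂ} (hB : MeasurableSet B) :
    f ⁻¹' B ∈ S.InvSets H := by
  refine ⟨(Lp.stronglyMeasurable f).measurable hB, fun g hg => ?_⟩
  rw [measure_symmDiff_eq_zero_iff]
  exact ((S.koopman_eq_self_iff g f).1 (hf g hg)).preimage B

theorem fixedVectors_le_of_invSets_subset (S : RSystem m X μ) {H K : Set (Fin m → ℝ)}
    (h : S.InvSets H ⊆ S.InvSets K) :
    fixedVectors S.koopman H ≤ fixedVectors S.koopman K := by
  intro f hf g hg
  rw [koopman_eq_self_iff]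
  refine Filter.EventuallyEq.of_forall_separating_preimage MeasurableSet fun B hB => ?_
  exact measure_symmDiff_eq_zero_iff.1 ((h (S.preimage_mem_invSets hf hB)).2 g hg)

theorem fixedVectors_eq_iff [IsFiniteMeasure μ] (S : RSystem m X μ) {H K : Set (Fin m → ℝ)} :
    fixedVectors S.koopman H = fixedVectors S.koopman K ↔ S.InvSets H = S.InvSets K := by
  refine ⟨fun h => ?_, fun h => le_antisymm
    (S.fixedVectors_le_of_invSets_subset h.subset) (S.fixedVectors_le_of_invSets_subset h.superset)⟩
  ext A
  refine ⟨fun hA => ?_, fun hA => ?_⟩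
  · rwa [← S.indicatorConstLp_mem_fixedVectors_iff _ hA.1, ← h,
      S.indicatorConstLp_mem_fixedVectors_iff _ hA.1]
  · rwa [← S.indicatorConstLp_mem_fixedVectors_iff _ hA.1, h,
      S.indicatorConstLp_mem_fixedVectors_iff _ hA.1]

end RSystem

/-- For any `ℝ^m`-system `X`, the set `W(X)` of non-ergodic directions is
the union of an at most countable family of proper linear subspaces of `ℝ^m`. -/
theorem W_eq_countable_union_of_proper_subspaces
    (m : ℕ) (X : Type) [MeasurableSpace X] (μ : Measure X) [IsProbabilityMeasure μ]
    (S : RSystem m X μ) :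
    ∃ 𝒱 : Set (Submodule ℝ (Fin m → ℝ)), 𝒱.Countable ∧ (∀ V ∈ 𝒱, V ≠ ⊤) ∧
      S.W = ⋃ V ∈ 𝒱, (V : Set (Fin m → ℝ)) := by
  refine ⟨{V | Maximal (fun V : Submodule ℝ (Fin m → ℝ) =>
    fixedVectors S.koopman V ≠ fixedVectors S.koopman Set.univ) V}, ?_, fun V hV hT => ?_, ?_⟩
  · have := S.separableL2
    exact countable_maximal_fixedVectors_ne S.koopman_zero S.koopman_add
  · exact (Set.mem_ofPred.1 hV).prop (by rw [hT, Submodule.top_coe])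
  · have range_eq : ∀ α : Fin m → ℝ,
        (Set.range fun t : ℝ => t • α) = (Submodule.span ℝ {α} : Set (Fin m → ℝ)) :=
      fun α => (Submodule.span_singleton_eq_range ℝ α).symm
    ext α
    simp only [RSystem.W, Set.mem_ofPred_eq, Set.mem_iUnion, SetLike.mem_coe, exists_prop, range_eq,
      ne_eq, ← S.fixedVectors_eq_iff]
    constructor
    · intro hα
      obtain ⟨V, hle, hV⟩ := exists_maximal_ge_of_wellFoundedGT
        (fun V : Submodule ℝ (Fin m → ℝ) =>
          fixedVectors S.koopman V ≠ fixedVectors S.koopman Set.univ) _ hα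
      exact ⟨V, hV, hle (Submodule.mem_span_singleton_self α)⟩
    · rintro ⟨V, hV, hαV⟩ h
      refine hV.prop (le_antisymm ?_ (fixedVectors_anti _ (Set.subset_univ _)))
      rw [← h]
      exact fixedVectors_anti _ ((Submodule.span_singleton_le_iff_mem α V).2 hαV)
end

section
/- Let m ∈ ℕ and let X be an ℝ^m-system such that for all bounded measurable f₁, f₂ : X → ℂ and all α₁, α₂ ∈ ℝ^m, the limit lim_{N→∞} (1/N) Σ_{n=0}^{N−1} f₁(T_{nα₁}x) f₂(T_{nα₂}x) exists for μ-a.e. x ∈ X. Then X is good for double Birkhoff averages. -/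
open MeasureTheory Filter Topology

/-- Replacing an interval `(0, T]` by `(0, ⌊T⌋]` does not affect the convergence of the averages
of a bounded function. -/
theorem tendsto_average_of_tendsto_nat_average {E : Type*} [NormedAddCommGroup E]
    [NormedSpace ℝ E] {φ : ℝ → E} {C : ℝ} {L : E}
    (hint : ∀ a b, IntervalIntegrable φ volume a b) (hC : ∀ t, ‖φ t‖ ≤ C)
    (hL : Tendsto (fun N : ℕ => (N : ℝ)⁻¹ • ∫ t in (0 : ℝ)..N, φ t) atTop (nhds L)) :
    Tendsto (fun T : ℝ => (1 / T : ℝ) • ∫ t in Set.Ioc (0 : ℝ) T, φ t) atTop (nhds L) := by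
  have hmain : Tendsto (fun T : ℝ => ((⌊T⌋₊ : ℝ) / T) •
      ((⌊T⌋₊ : ℝ)⁻¹ • ∫ t in (0 : ℝ)..(⌊T⌋₊ : ℝ), φ t)) atTop (nhds ((1 : ℝ) • L)) :=
    (tendsto_nat_floor_div_atTop (R := ℝ)).smul (hL.comp tendsto_nat_floor_atTop)
  have hrest : Tendsto (fun T : ℝ => T⁻¹ • ∫ t in (⌊T⌋₊ : ℝ)..T, φ t) atTop (nhds 0) := by
    have h0 : Tendsto (fun T : ℝ => T⁻¹ * C) atTop (nhds 0) := by
      simpa using tendsto_inv_atTop_zero.mul_const C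
    refine squeeze_zero_norm' ?_ h0
    filter_upwards [eventually_gt_atTop 0] with T hT
    rw [norm_smul, norm_inv, Real.norm_of_nonneg hT.le]
    gcongr
    have h1 : (⌊T⌋₊ : ℝ) ≤ T := Nat.floor_le hT.le
    have h2 : T < ⌊T⌋₊ + 1 := Nat.lt_floor_add_one T
    have hC0 : 0 ≤ C := (norm_nonneg _).trans (hC 0)
    refine (intervalIntegral.norm_integral_le_of_norm_le_const fun t _ => hC t).trans ?_
    rw [abs_of_nonneg (by linarith)]
    exact mul_le_of_le_one_right hC0 (by linarith)
  have hsum := hmain.add hrest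
  rw [one_smul, add_zero] at hsum
  refine hsum.congr' ?_
  filter_upwards [eventually_ge_atTop 1] with T hT
  have hfl : (⌊T⌋₊ : ℝ) ≠ 0 := by
    have := Nat.floor_pos.2 hT
    positivity
  rw [smul_smul, div_mul_eq_mul_div, mul_inv_cancel₀ hfl, one_div, ← smul_add,
    intervalIntegral.integral_add_adjacent_intervals (hint _ _) (hint _ _),
    intervalIntegral.integral_of_le (by linarith)]

/-- If for almost every `s ∈ (0, 1]` the discrete averages of a bounded measurable function along
`s + ℕ` converge, then so do its continuous averages. -/
theorem exists_tendsto_average_of_ae_exists_tendsto {φ : ℝ → ℂ} {C : ℝ} (hφ : Measurable φ)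
    (hC : ∀ t, ‖φ t‖ ≤ C)
    (h : ∀ᵐ s ∂volume.restrict (Set.Ioc (0 : ℝ) 1), ∃ L : ℂ,
      Tendsto (fun N : ℕ => (N : ℂ)⁻¹ • ∑ n ∈ Finset.range N, φ (n + s)) atTop (nhds L)) :
    ∃ L : ℂ, Tendsto (fun T : ℝ => (1 / T : ℝ) • ∫ t in Set.Ioc (0 : ℝ) T, φ t)
      atTop (nhds L) := by
  have hint : ∀ ψ : ℝ → ℂ, Measurable ψ → (∀ t, ‖ψ t‖ ≤ C) →
      ∀ a b, IntervalIntegrable ψ volume a b := fun ψ hψ hb a b =>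
    (intervalIntegrable_const (c := C)).mono_fun hψ.aestronglyMeasurable
      (.of_forall fun t => (hb t).trans (Real.le_norm_self C))
  set A : ℕ → ℝ → ℂ := fun N s => (N : ℂ)⁻¹ • ∑ n ∈ Finset.range N, φ (n + s) with hA
  have hlim : Tendsto (fun N => ∫ s in Set.Ioc (0 : ℝ) 1, A N s) atTop
      (nhds (∫ s in Set.Ioc (0 : ℝ) 1, limUnder atTop fun N => A N s)) := by
    refine tendsto_integral_of_dominated_convergence (fun _ => C) (fun N => ?_)
      (integrable_const C) (fun N => .of_forall fun s => ?_) ?_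
    · refine Measurable.aestronglyMeasurable ?_
      fun_prop
    · have hC0 : 0 ≤ C := (norm_nonneg _).trans (hC 0)
      have hs : ‖∑ n ∈ Finset.range N, φ (n + s)‖ ≤ N * C := by
        simpa using norm_sum_le_of_le (Finset.range N) fun n _ => hC (n + s)
      rw [hA, norm_smul, norm_inv, Complex.norm_natCast]
      rcases N.eq_zero_or_pos with rfl | hN
      · simpa using hC0
      · rw [inv_mul_le_iff₀ (by positivity)]
        exact hs
    · filter_upwards [h] with s hs
      exact tendsto_nhds_limUnder hs
  refine ⟨_, tendsto_average_of_tendsto_nat_average (hint φ hφ hC) hC (hlim.congr fun N => ?_)⟩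
  have hshift : ∀ n : ℕ, ∫ s in (0 : ℝ)..1, φ (n + s) = ∫ t in (n : ℝ)..(n + 1 : ℕ), φ t := by
    intro n
    simp [intervalIntegral.integral_comp_add_left (fun t => φ t) (n : ℝ)]
  have hadj := intervalIntegral.sum_integral_adjacent_intervals (f := φ) (μ := volume)
    (a := fun n : ℕ => (n : ℝ)) (n := N) fun n _ => hint φ hφ hC _ _
  rw [← intervalIntegral.integral_of_le zero_le_one, hA, intervalIntegral.integral_smul,
    intervalIntegral.integral_finsetSum (f := fun (n : ℕ) s => φ (n + s)) fun n _ =>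
      hint _ (hφ.comp (measurable_const_add _)) (fun t => hC _) _ _,
    Finset.sum_congr rfl fun n _ => hshift n, hadj, Nat.cast_zero, ← Complex.ofReal_natCast,
    ← Complex.ofReal_inv, Complex.coe_smul]

theorem RSystem.measurable_comp_flow {m : ℕ} {X : Type*} [MeasurableSpace X] {μ : Measure X}
    (S : RSystem m X μ) {f : X → ℂ} (hf : Measurable f) (α : Fin m → ℝ) :
    Measurable fun p : ℝ × X => f (S.T (p.1 • α) p.2) :=
  hf.comp (S.measurable_pair.comp (by fun_prop : Measurable fun p : ℝ × X => (p.1 • α, p.2)))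

/-- If for all bounded measurable `f₁ f₂` and all `α₁ α₂ ∈ ℝ^m` the discrete
double Birkhoff averages `(1/N) ∑_{n=0}^{N-1} f₁(T_{nα₁}x) f₂(T_{nα₂}x)` converge for
`μ`-a.e. `x`, then the system is good for double Birkhoff averages. -/
theorem goodForDoubleBirkhoff_of_discrete_double_averages_converge
    (m : ℕ) (X : Type) [MeasurableSpace X] (μ : Measure X) [IsProbabilityMeasure μ]
    (S : RSystem m X μ)
    (h : ∀ (f₁ f₂ : X → ℂ), Measurable f₁ → Measurable f₂ →
      (∃ C, ∀ x, ‖f₁ x‖ ≤ C) → (∃ C, ∀ x, ‖f₂ x‖ ≤ C) →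
      ∀ α₁ α₂ : Fin m → ℝ, ∀ᵐ x ∂μ, ∃ L : ℂ,
        Tendsto (fun N : ℕ => (N : ℂ)⁻¹ •
            ∑ n ∈ Finset.range N, f₁ (S.T ((n : ℝ) • α₁) x) * f₂ (S.T ((n : ℝ) • α₂) x))
          atTop (nhds L)) :
    S.GoodForDoubleBirkhoff := by
  rintro f₁ f₂ hf₁ hf₂ ⟨C₁, hC₁⟩ ⟨C₂, hC₂⟩ α₁ α₂
  set φ : ℝ × X → ℂ := fun p => f₁ (S.T (p.1 • α₁) p.2) * f₂ (S.T (p.1 • α₂) p.2) with hφ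
  have hφm : Measurable φ :=
    (S.measurable_comp_flow hf₁ α₁).mul (S.measurable_comp_flow hf₂ α₂)
  have hmeas : MeasurableSet {p : X × ℝ | ∃ L : ℂ, Tendsto (fun N : ℕ =>
      (N : ℂ)⁻¹ • ∑ n ∈ Finset.range N, φ (n + p.2, p.1)) atTop (nhds L)} := by
    refine measurableSet_exists_tendsto fun N => ?_
    fun_prop
  have hae : ∀ᵐ x ∂μ, ∀ᵐ s ∂volume.restrict (Set.Ioc (0 : ℝ) 1), ∃ L : ℂ,
      Tendsto (fun N : ℕ => (N : ℂ)⁻¹ • ∑ n ∈ Finset.range N, φ (n + s, x)) atTop (nhds L) := by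
    rw [Measure.ae_ae_comm hmeas]
    refine .of_forall fun s => ?_
    have hm : ∀ α, Measurable (S.T α) := fun α => (S.measurePreserving α).measurable
    filter_upwards [h (f₁ ∘ S.T (s • α₁)) (f₂ ∘ S.T (s • α₂)) (hf₁.comp (hm _))
      (hf₂.comp (hm _)) ⟨C₁, fun x => hC₁ _⟩ ⟨C₂, fun x => hC₂ _⟩ α₁ α₂] with x hx
    have hT : ∀ (n : ℕ) (α : Fin m → ℝ),
        S.T (s • α) (S.T ((n : ℝ) • α) x) = S.T (((n : ℝ) + s) • α) x := fun n α => by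
      rw [← Function.comp_apply (f := S.T _), S.T_add, add_comm, add_smul]
    simpa only [hφ, Function.comp_apply, hT] using hx
  filter_upwards [hae] with x hx
  refine exists_tendsto_average_of_ae_exists_tendsto (φ := fun t => φ (t, x)) (C := C₁ * C₂)
    (hφm.comp measurable_prodMk_right) (fun t => ?_) hx
  rw [norm_mul]
  exact mul_le_mul (hC₁ _) (hC₂ _) (norm_nonneg _) ((norm_nonneg _).trans (hC₁ x))
end

section
/- Let m ∈ ℕ, let β ∈ ℝ^m with β ≠ 0, and let c ∈ ℝ. Let X₀ be the ℝ^m-system on the circle ℝ/ℤ with its Borel σ-algebra and Haar (Lebesgue) probability measure, with action T_α x = x + (α·β) mod 1, where α·β denotes the standard inner product on ℝ^m. Then: (i) X₀ is an ergodic ℝ^m-system; (ii) X₀ is good for double Birkhoff averages; and (iii) every Borel probability measure ν on ℝ^m with ν({α ∈ ℝ^m : α·β = c}) > 0 is not weakly equidistributed for X₀. -/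
open MeasureTheory Filter Topology

theorem exists_tendsto_of_forall_eventually_near {ι E : Type*} [NormedAddCommGroup E]
    [CompleteSpace E] {l : Filter ι} [l.NeBot] {v : ι → E}
    (h : ∀ ε > 0, ∃ u : ι → E, (∃ L, Tendsto u l (𝓝 L)) ∧ ∀ᶠ i in l, ‖v i - u i‖ ≤ ε) :
    ∃ L, Tendsto v l (𝓝 L) := by
  rw [← cauchy_map_iff_exists_tendsto, Metric.cauchy_iff]
  refine ⟨inferInstance, fun ε hε => ?_⟩
  obtain ⟨u, ⟨L, hL⟩, hu⟩ := h (ε / 5) (by positivity)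
  refine ⟨_, image_mem_map (hu.and (Metric.tendsto_nhds.1 hL (ε / 5) (by positivity))), ?_⟩
  rintro _ ⟨i, ⟨hi, hi'⟩, rfl⟩ _ ⟨j, ⟨hj, hj'⟩, rfl⟩
  rw [← dist_eq_norm] at hi hj
  have h1 := dist_triangle4 (v i) (u i) (u j) (v j)
  have h2 := dist_triangle_right (u i) (u j) L
  rw [dist_comm (u j)] at h1
  linarith

/-- The average of `g` over `(0, T]`. -/
noncomputable def timeAverage (g : ℝ → ℂ) (T : ℝ) : ℂ :=
  (1 / T : ℝ) • ∫ t in Set.Ioc (0 : ℝ) T, g t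

/-- The averages of `g` over `(0, T]` converge as `T → ∞`. -/
def HasTimeAverage (g : ℝ → ℂ) : Prop :=
  ∃ L, Tendsto (timeAverage g) atTop (𝓝 L)

theorem HasTimeAverage.const_mul {g : ℝ → ℂ} (hg : HasTimeAverage g) (c : ℂ) :
    HasTimeAverage fun t => c * g t := by
  obtain ⟨L, hL⟩ := hg
  refine ⟨c * L, (hL.const_mul c).congr fun T => ?_⟩
  simp only [timeAverage, integral_const_mul, mul_smul_comm]

theorem HasTimeAverage.add {g h : ℝ → ℂ} (hg : HasTimeAverage g) (hh : HasTimeAverage h)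
    (hgi : LocallyIntegrable g) (hhi : LocallyIntegrable h) :
    HasTimeAverage fun t => g t + h t := by
  obtain ⟨L, hL⟩ := hg
  obtain ⟨M, hM⟩ := hh
  refine ⟨L + M, (hL.add hM).congr fun T => ?_⟩
  have hi {k : ℝ → ℂ} (hk : LocallyIntegrable k) : IntegrableOn k (Set.Ioc 0 T) :=
    (hk.integrableOn_isCompact isCompact_Icc).mono_set Set.Ioc_subset_Icc_self
  simp only [timeAverage, integral_add (hi hgi) (hi hhi), smul_add]

theorem hasTimeAverage_exp (θ : ℝ) :
    HasTimeAverage fun t : ℝ => Complex.exp (θ * Complex.I * t) := by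
  rcases eq_or_ne θ 0 with rfl | hθ
  · refine ⟨1, tendsto_const_nhds.congr' ?_⟩
    filter_upwards [eventually_gt_atTop 0] with T hT
    simp [timeAverage, hT.le, hT.ne']
  · have hc : (θ * Complex.I : ℂ) ≠ 0 := by simpa using hθ
    refine ⟨0, squeeze_zero_norm' (a := fun T => 2 / |θ| * T⁻¹) ?_
      (by simpa using tendsto_inv_atTop_zero.const_mul (2 / |θ|))⟩
    filter_upwards [eventually_gt_atTop 0] with T hT
    rw [timeAverage, ← intervalIntegral.integral_of_le hT.le, integral_exp_mul_complex hc,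
      norm_smul, norm_div _ (θ * Complex.I : ℂ), mul_comm, one_div, norm_inv,
      Real.norm_of_nonneg hT.le]
    have he (s : ℝ) : ‖Complex.exp (θ * Complex.I * s)‖ = 1 := by
      rw [mul_right_comm, ← Complex.ofReal_mul, Complex.norm_exp_ofReal_mul_I]
    have h2 := norm_sub_le (Complex.exp (θ * Complex.I * T)) (Complex.exp (θ * Complex.I * (0 : ℝ)))
    rw [he, he] at h2
    have h3 : ‖(θ * Complex.I : ℂ)‖ = |θ| := by simp
    rw [h3]
    gcongr
    linarith

theorem locallyIntegrable_of_bounded {g : ℝ → ℂ} (hg : Measurable g) {C : ℝ}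
    (hC : ∀ t, ‖g t‖ ≤ C) : LocallyIntegrable g :=
  (memLp_top_of_bound hg.aestronglyMeasurable C (ae_of_all _ hC)).locallyIntegrable le_top

theorem exists_int_mul_inv_mem_Icc {a : ℝ} (ha : a ≠ 0) {T : ℝ} (hT : |a|⁻¹ ≤ T) :
    ∃ n : ℤ, n * a⁻¹ ∈ Set.Icc T (2 * T) := by
  have h (b : ℝ) (hb : 0 < b) (hT : b⁻¹ ≤ T) : ∃ n : ℤ, n * b⁻¹ ∈ Set.Icc T (2 * T) := by
    have h1 := Int.le_ceil (T * b)
    have h2 := Int.ceil_lt_add_one (T * b)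
    have h3 : 1 ≤ T * b := (inv_le_iff_one_le_mul₀ hb).1 hT
    refine ⟨⌈T * b⌉, ?_, ?_⟩ <;> rw [← div_eq_mul_inv]
    · rwa [le_div_iff₀ hb]
    · rw [div_le_iff₀ hb]; linarith
  rcases ha.lt_or_gt with ha | ha
  · rw [abs_of_neg ha] at hT
    obtain ⟨n, hn⟩ := h (-a) (by linarith) hT
    exact ⟨-n, by simpa [inv_neg] using hn⟩
  · exact h a ha (by rwa [abs_of_pos ha] at hT)

/-- Along a nontrivial rotation, the integral of a nonnegative function over a long time `T` is
at most `2 * T` times its space average. -/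
theorem setIntegral_rotation_le {h : AddCircle (1 : ℝ) → ℝ} (hm : Measurable h)
    (h0 : ∀ y, 0 ≤ h y) {C : ℝ} (hC : ∀ y, h y ≤ C) {a : ℝ} (ha : a ≠ 0) (x : AddCircle (1 : ℝ))
    {T : ℝ} (hT : |a|⁻¹ ≤ T) :
    ∫ t in Set.Ioc 0 T, h (x + ((t * a : ℝ) : AddCircle (1 : ℝ))) ≤ 2 * T * ∫ y, h y := by
  induction x using QuotientAddGroup.induction_on with | _ x
  have hT0 : 0 < T := (inv_pos.2 (abs_pos.2 ha)).trans_le hT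
  obtain ⟨n, hn⟩ := exists_int_mul_inv_mem_Icc ha hT
  set F : ℝ → ℝ := fun t => h ((x : AddCircle (1 : ℝ)) + ((t * a : ℝ) : AddCircle (1 : ℝ))) with hF
  have hFm : Measurable F := by
    have := AddCircle.measurable_mk' (a := (1 : ℝ))
    fun_prop
  have hFi (s t : ℝ) : IntervalIntegrable F volume s t :=
    (intervalIntegrable_const (c := C)).mono_fun hFm.aestronglyMeasurable
      (ae_of_all _ fun t => by
        simpa only [Real.norm_of_nonneg (h0 _), Real.norm_of_nonneg ((h0 0).trans (hC 0)), hF]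
          using hC _)
  have hper : Function.Periodic F a⁻¹ := fun t => by
    simp only [hF, add_mul, inv_mul_cancel₀ ha, AddCircle.coe_add, AddCircle.coe_period, add_zero]
  have hone : ∫ t in (0 : ℝ)..a⁻¹, F t = a⁻¹ * ∫ y, h y := by
    have := intervalIntegral.integral_comp_mul_add (a := 0) (b := a⁻¹)
      (fun s : ℝ => h (s : AddCircle (1 : ℝ))) ha x
    rw [mul_zero, mul_inv_cancel₀ ha, zero_add, add_comm (1 : ℝ),
      UnitAddCircle.intervalIntegral_preimage, smul_eq_mul] at this
    rw [← this]
    congr 1 with t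
    simp [hF, mul_comm, add_comm]
  calc ∫ t in Set.Ioc 0 T, F t = ∫ t in (0 : ℝ)..T, F t :=
        (intervalIntegral.integral_of_le hT0.le).symm
    _ ≤ ∫ t in (0 : ℝ)..n * a⁻¹, F t :=
        intervalIntegral.integral_mono_interval le_rfl hT0.le hn.1
          (ae_of_all _ fun _ => h0 _) (hFi _ _)
    _ = n * a⁻¹ * ∫ y, h y := by
        have := hper.intervalIntegral_add_zsmul_eq n 0 hFi
        simp only [zero_add, zsmul_eq_mul, hone] at this
        rw [this, mul_assoc]
    _ ≤ 2 * T * ∫ y, h y := mul_le_mul_of_nonneg_right hn.2 (integral_nonneg h0)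

theorem measurable_comp_rotation {f : AddCircle (1 : ℝ) → ℂ} (hf : Measurable f)
    (x : AddCircle (1 : ℝ)) (a : ℝ) :
    Measurable fun t : ℝ => f (x + ((t * a : ℝ) : AddCircle (1 : ℝ))) := by
  have := AddCircle.measurable_mk' (a := (1 : ℝ))
  fun_prop

theorem locallyIntegrable_rotation_mul {f : AddCircle (1 : ℝ) → ℂ} (hf : Measurable f)
    (hfb : ∃ C, ∀ y, ‖f y‖ ≤ C) {φ : ℝ → ℂ} (hφ : Measurable φ) (hφb : ∃ C, ∀ t, ‖φ t‖ ≤ C)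
    (x : AddCircle (1 : ℝ)) (a : ℝ) :
    LocallyIntegrable fun t : ℝ => f (x + ((t * a : ℝ) : AddCircle (1 : ℝ))) * φ t := by
  obtain ⟨C, hC⟩ := hfb
  obtain ⟨D, hD⟩ := hφb
  refine locallyIntegrable_of_bounded ((measurable_comp_rotation hf x a).mul hφ) (C := C * D)
    fun t => ?_
  rw [norm_mul]
  exact mul_le_mul (hC _) (hD _) (norm_nonneg _) ((norm_nonneg _).trans (hC 0))

theorem hasTimeAverage_rotation_mul_of_approx {f : AddCircle (1 : ℝ) → ℂ} (hf : Measurable f)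
    (hfb : ∃ C, ∀ y, ‖f y‖ ≤ C) {φ : ℝ → ℂ} (hφ : Measurable φ) (hφb : ∃ C, ∀ t, ‖φ t‖ ≤ C)
    (x : AddCircle (1 : ℝ)) {a : ℝ} (ha : a ≠ 0)
    (happ : ∀ ε > 0, ∃ g : AddCircle (1 : ℝ) → ℂ, Measurable g ∧ (∃ C, ∀ y, ‖g y‖ ≤ C) ∧
      ∫ y, ‖f y - g y‖ ≤ ε ∧
      HasTimeAverage fun t => g (x + ((t * a : ℝ) : AddCircle (1 : ℝ))) * φ t) :
    HasTimeAverage fun t => f (x + ((t * a : ℝ) : AddCircle (1 : ℝ))) * φ t := by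
  obtain ⟨D, hD⟩ := id hφb
  have hD0 : 0 ≤ D := (norm_nonneg _).trans (hD 0)
  refine exists_tendsto_of_forall_eventually_near fun ε hε => ?_
  obtain ⟨g, hg, hgb, hfg, hlim⟩ := happ (ε / (2 * (D + 1))) (by positivity)
  refine ⟨_, hlim, ?_⟩
  filter_upwards [eventually_ge_atTop |a|⁻¹] with T hT
  have hT0 : 0 < T := (inv_pos.2 (abs_pos.2 ha)).trans_le hT
  have hi {k : ℝ → ℂ} (hk : LocallyIntegrable k) : IntegrableOn k (Set.Ioc 0 T) :=
    (hk.integrableOn_isCompact isCompact_Icc).mono_set Set.Ioc_subset_Icc_self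
  obtain ⟨C, hC⟩ := id hfb
  obtain ⟨C', hC'⟩ := id hgb
  have hb (y) : ‖f y - g y‖ ≤ C + C' := (norm_sub_le _ _).trans (add_le_add (hC y) (hC' y))
  have hmain := setIntegral_rotation_le (hf.sub hg).norm (fun _ => norm_nonneg _) hb ha x hT
  have hdi := hi (locallyIntegrable_rotation_mul (f := fun y => f y - g y) (hf.sub hg) ⟨_, hb⟩
    (measurable_const (a := (1 : ℂ))) ⟨1, by simp⟩ x a)
  simp only [mul_one] at hdi
  rw [timeAverage, timeAverage, ← smul_sub,
    ← integral_sub (hi (locallyIntegrable_rotation_mul hf hfb hφ hφb x a))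
      (hi (locallyIntegrable_rotation_mul hg hgb hφ hφb x a)),
    norm_smul, Real.norm_of_nonneg (by positivity)]
  simp only [← sub_mul]
  calc 1 / T * ‖∫ t in Set.Ioc 0 T, (f (x + ((t * a : ℝ) : AddCircle (1 : ℝ))) -
          g (x + ((t * a : ℝ) : AddCircle (1 : ℝ)))) * φ t‖
      ≤ 1 / T * ∫ t in Set.Ioc 0 T, ‖f (x + ((t * a : ℝ) : AddCircle (1 : ℝ))) -
          g (x + ((t * a : ℝ) : AddCircle (1 : ℝ)))‖ * D := by
        gcongr
        refine norm_integral_le_of_norm_le (hdi.norm.mul_const D) (ae_of_all _ fun t => ?_)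
        rw [norm_mul]
        exact mul_le_mul_of_nonneg_left (hD t) (norm_nonneg _)
    _ ≤ 1 / T * (2 * T * (ε / (2 * (D + 1))) * D) := by
        rw [integral_mul_const]
        gcongr
        exact hmain.trans (mul_le_mul_of_nonneg_left hfg (by positivity))
    _ = ε * (D / (D + 1)) := by field_simp
    _ ≤ ε := mul_le_of_le_one_right hε.le ((div_le_one (by positivity)).2 (by linarith))

/-- Time averages of `f (x + t a) φ(t)` exist for all bounded measurable `f` as soon as they exist
when `f` is a character. -/
theorem hasTimeAverage_rotation_mul {f : AddCircle (1 : ℝ) → ℂ} (hf : Measurable f)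
    (hfb : ∃ C, ∀ y, ‖f y‖ ≤ C) {φ : ℝ → ℂ} (hφ : Measurable φ) (hφb : ∃ C, ∀ t, ‖φ t‖ ≤ C)
    (x : AddCircle (1 : ℝ)) (a : ℝ)
    (hfourier : ∀ n : ℤ,
      HasTimeAverage fun t => fourier n (x + ((t * a : ℝ) : AddCircle (1 : ℝ))) * φ t) :
    HasTimeAverage fun t => f (x + ((t * a : ℝ) : AddCircle (1 : ℝ))) * φ t := by
  rcases eq_or_ne a 0 with rfl | ha
  · have h0 := hfourier 0
    simp only [fourier_zero, one_mul] at h0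
    simpa using h0.const_mul (f x)
  have hcb (g : C(AddCircle (1 : ℝ), ℂ)) : ∃ C, ∀ y, ‖g y‖ ≤ C := ⟨‖g‖, g.norm_coe_le_norm⟩
  have hspan (g : C(AddCircle (1 : ℝ), ℂ)) (hg : g ∈ Submodule.span ℂ (Set.range fourier)) :
      HasTimeAverage fun t => g (x + ((t * a : ℝ) : AddCircle (1 : ℝ))) * φ t := by
    induction hg using Submodule.span_induction with
    | mem g hg => obtain ⟨n, rfl⟩ := hg; exact hfourier n
    | zero => simpa using (hfourier 0).const_mul 0
    | add g h _ _ hg hh =>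
      simpa only [ContinuousMap.add_apply, add_mul] using hg.add hh
        (locallyIntegrable_rotation_mul g.continuous.measurable (hcb g) hφ hφb x a)
        (locallyIntegrable_rotation_mul h.continuous.measurable (hcb h) hφ hφb x a)
    | smul c g _ hg =>
      simpa only [ContinuousMap.smul_apply, smul_eq_mul, mul_assoc] using hg.const_mul c
  have hcont (g : C(AddCircle (1 : ℝ), ℂ)) :
      HasTimeAverage fun t => g (x + ((t * a : ℝ) : AddCircle (1 : ℝ))) * φ t := by
    refine hasTimeAverage_rotation_mul_of_approx g.continuous.measurable (hcb g) hφ hφb x ha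
      fun ε hε => ?_
    have hg : g ∈ (Submodule.span ℂ (Set.range <| @fourier (1 : ℝ))).topologicalClosure := by
      rw [span_fourier_closure_eq_top]; trivial
    obtain ⟨k, hk, hgk⟩ := Metric.mem_closure_iff.1 hg ε hε
    refine ⟨k, k.continuous.measurable, hcb k, ?_, hspan k hk⟩
    have hle (y) : ‖g y - k y‖ ≤ ε := by
      rw [← dist_eq_norm]
      exact (ContinuousMap.dist_apply_le_dist y).trans hgk.le
    calc ∫ y, ‖g y - k y‖ ≤ ∫ _ : AddCircle (1 : ℝ), ε :=
          integral_mono ((g - k).continuous.norm.integrable_of_hasCompactSupport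
            (HasCompactSupport.of_compactSpace _)) (integrable_const _) hle
      _ = ε := by simp [measureReal_def]
  refine hasTimeAverage_rotation_mul_of_approx hf hfb hφ hφb x ha fun ε hε => ?_
  obtain ⟨C, hC⟩ := id hfb
  have hfi : Integrable f := Integrable.of_bound hf.aestronglyMeasurable C (ae_of_all _ hC)
  obtain ⟨g, hg, -⟩ := hfi.exists_boundedContinuous_integral_sub_le hε
  exact ⟨g, g.continuous.measurable, ⟨‖g‖, g.norm_coe_le_norm⟩, hg, hcont g.toContinuousMap⟩

theorem fourier_rotation (n : ℤ) (x : AddCircle (1 : ℝ)) (t a : ℝ) :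
    fourier n (x + ((t * a : ℝ) : AddCircle (1 : ℝ))) =
      fourier n x * Complex.exp ((2 * Real.pi * n * a : ℝ) * Complex.I * t) := by
  rw [show fourier n (x + ((t * a : ℝ) : AddCircle (1 : ℝ))) =
      fourier n x * fourier n ((t * a : ℝ) : AddCircle (1 : ℝ)) by
    simp [smul_add, AddCircle.toCircle_add], fourier_coe_apply]
  congr 2
  push_cast
  ring

theorem hasTimeAverage_rotation_mul_rotation {f₁ f₂ : AddCircle (1 : ℝ) → ℂ}
    (hf₁ : Measurable f₁) (hf₂ : Measurable f₂) (hb₁ : ∃ C, ∀ y, ‖f₁ y‖ ≤ C)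
    (hb₂ : ∃ C, ∀ y, ‖f₂ y‖ ≤ C) (x : AddCircle (1 : ℝ)) (a b : ℝ) :
    HasTimeAverage fun t => f₁ (x + ((t * a : ℝ) : AddCircle (1 : ℝ))) *
      f₂ (x + ((t * b : ℝ) : AddCircle (1 : ℝ))) := by
  refine hasTimeAverage_rotation_mul hf₁ hb₁ (measurable_comp_rotation hf₂ x b)
    (hb₂.imp fun C hC t => hC _) x a fun n => ?_
  simp only [mul_comm (fourier n _)]
  refine hasTimeAverage_rotation_mul hf₂ hb₂
    (measurable_comp_rotation (fourier n).continuous.measurable x a)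
    ⟨‖fourier n‖, fun t => (fourier n).norm_coe_le_norm _⟩ x b fun k => ?_
  convert (hasTimeAverage_exp (2 * Real.pi * k * b + 2 * Real.pi * n * a)).const_mul
    (fourier k x * fourier n x) using 2 with t
  rw [fourier_rotation, fourier_rotation, mul_mul_mul_comm, ← Complex.exp_add]
  congr 2
  push_cast
  ring

theorem ergodic_add_sqrt_two :
    Ergodic fun x : AddCircle (1 : ℝ) => x + ((√2 : ℝ) : AddCircle (1 : ℝ)) := by
  rw [AddCircle.ergodic_add_right, addOrderOf_eq_zero_iff,
    AddCircle.not_isOfFinAddOrder_iff_forall_rat_ne_div]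
  simpa [Irrational] using irrational_sqrt_two

theorem exists_sum_mul_eq {ι : Type*} [Fintype ι] {β : ι → ℝ} (hβ : β ≠ 0) (s : ℝ) :
    ∃ α : ι → ℝ, ∑ i, α i * β i = s := by
  classical
  obtain ⟨j, hj⟩ := Function.ne_iff.1 hβ
  have hj : β j ≠ 0 := hj
  exact ⟨Pi.single j (s / β j), by simp [Pi.single_apply, hj]⟩

theorem HasDensityOne.neBot {A : Set ℝ} (hA : HasDensityOne A) : (atTop ⊓ 𝓟 A).NeBot := by
  rw [← frequently_mem_iff_neBot]
  intro hev
  obtain ⟨K, hK⟩ := eventually_atTop.1 hev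
  have hlim : Tendsto (fun T : ℝ => (volume (A ∩ Set.Icc 0 T)).toReal / T) atTop (𝓝 0) := by
    refine squeeze_zero' (g := fun T => |K| / T) ?_ ?_ (tendsto_const_nhds.div_atTop tendsto_id)
    · filter_upwards [eventually_gt_atTop 0] with T hT
      positivity
    · filter_upwards [eventually_gt_atTop 0] with T hT
      gcongr
      have hsub : A ∩ Set.Icc 0 T ⊆ Set.Icc 0 |K| := fun t ht =>
        ⟨ht.2.1, (not_le.1 fun h => hK t h ht.1).le.trans (le_abs_self K)⟩
      simpa using ENNReal.toReal_mono (by simp) (measure_mono hsub (μ := volume))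
  exact one_ne_zero (tendsto_nhds_unique hA hlim)

/-- The rotation action of `ℝ^m` on the circle with frequency vector `β`. -/
noncomputable def circleRotationSystem {m : ℕ} (β : Fin m → ℝ) :
    RSystem m (AddCircle (1 : ℝ)) volume where
  T α x := x + ((∑ i, α i * β i : ℝ) : AddCircle (1 : ℝ))
  measurable_pair := by
    have := AddCircle.measurable_mk' (a := (1 : ℝ))
    fun_prop
  measurePreserving α := measurePreserving_add_right _ _
  T_zero := by ext x; simp
  T_add α γ := by
    ext x
    simp [add_mul, Finset.sum_add_distrib, add_comm, add_left_comm]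
  separableL2 := by
    have : SecondCountableTopology (AddCircle (1 : ℝ)) :=
      inferInstanceAs (SecondCountableTopology (ℝ ⧸ AddSubgroup.zmultiples (1 : ℝ)))
    have : Fact ((2 : ENNReal) ≠ ⊤) := ⟨ENNReal.ofNat_ne_top⟩
    infer_instance

namespace circleRotationSystem

variable {m : ℕ} (β : Fin m → ℝ)

theorem T_apply (α : Fin m → ℝ) (x : AddCircle (1 : ℝ)) :
    (circleRotationSystem β).T α x = x + ((∑ i, α i * β i : ℝ) : AddCircle (1 : ℝ)) := rfl

theorem T_smul_apply (t : ℝ) (α : Fin m → ℝ) (x : AddCircle (1 : ℝ)) :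
    (circleRotationSystem β).T (t • α) x =
      x + ((t * ∑ i, α i * β i : ℝ) : AddCircle (1 : ℝ)) := by
  simp only [T_apply, Pi.smul_apply, smul_eq_mul, mul_assoc, Finset.mul_sum]

theorem isErgodic (hβ : β ≠ 0) : (circleRotationSystem β).IsErgodic := by
  intro A hA hinv
  obtain ⟨α, hα⟩ := exists_sum_mul_eq hβ (√2)
  have hT : (circleRotationSystem β).T α = fun x => x + ((√2 : ℝ) : AddCircle (1 : ℝ)) := by
    ext x; rw [T_apply, hα]
  have hα' := hinv α
  rw [hT, measure_symmDiff_eq_zero_iff] at hα'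
  rcases ergodic_add_sqrt_two.quasiErgodic.ae_empty_or_univ₀ hA.nullMeasurableSet hα' with h | h
  · exact Or.inl (by rw [measure_congr h, measure_empty])
  · exact Or.inr (by rw [measure_congr h, UnitAddCircle.measure_univ])

theorem goodForDoubleBirkhoff : (circleRotationSystem β).GoodForDoubleBirkhoff := by
  intro f₁ f₂ hf₁ hf₂ hb₁ hb₂ α₁ α₂
  refine ae_of_all _ fun x => ?_
  simp only [T_smul_apply]
  exact hasTimeAverage_rotation_mul_rotation hf₁ hf₂ hb₁ hb₂ x _ _

theorem not_weaklyEquidistributed (c : ℝ) (ν : Measure (Fin m → ℝ)) [IsProbabilityMeasure ν]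
    (hν : 0 < ν {α : Fin m → ℝ | ∑ i, α i * β i = c}) :
    ¬ (circleRotationSystem β).WeaklyEquidistributed ν := by
  rintro ⟨A, -, hA, hf⟩
  have := hA.neBot
  set p := ν.real {α : Fin m → ℝ | ∑ i, α i * β i = c}
  have hp0 : 0 < p := ENNReal.toReal_pos hν.ne' (measure_ne_top _ _)
  set B : Set (AddCircle (1 : ℝ)) := Metric.closedBall 0 (p / 4)
  have hBm : MeasurableSet B := Metric.isClosed_closedBall.measurableSet
  have hp1 : p ≤ 1 := measureReal_le_one
  have hBv : volume.real B = p / 2 := by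
    rw [measureReal_def, AddCircle.volume_closedBall, min_eq_right (by linarith),
      ENNReal.toReal_ofReal (by positivity)]
    ring
  have hfB := hf (B.indicator 1) (measurable_one.indicator hBm)
    ⟨1, fun x => (norm_indicator_le_norm_self _ _).trans (by simp)⟩
  have havg (t : ℝ) (x : AddCircle (1 : ℝ)) :
      ∫ α : Fin m → ℝ, B.indicator (1 : AddCircle (1 : ℝ) → ℂ)
          (x + ((t * ∑ i, α i * β i : ℝ) : AddCircle (1 : ℝ))) ∂ν =
        (ν.real ((fun α : Fin m → ℝ =>
          x + ((t * ∑ i, α i * β i : ℝ) : AddCircle (1 : ℝ))) ⁻¹' B) : ℂ) := by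
    have hm : Measurable fun α : Fin m → ℝ =>
        x + ((t * ∑ i, α i * β i : ℝ) : AddCircle (1 : ℝ)) := by
      have := AddCircle.measurable_mk' (a := (1 : ℝ))
      fun_prop
    have h := integral_indicator_const (μ := ν) (1 : ℂ) (hm hBm)
    rw [Complex.real_smul, mul_one] at h
    exact h
  have hlim : ∀ᵐ x : AddCircle (1 : ℝ), Tendsto (fun t : ℝ =>
      B.indicator (1 : AddCircle (1 : ℝ) → ℝ)
      (x + ((t * c : ℝ) : AddCircle (1 : ℝ)))) (atTop ⊓ 𝓟 A) (𝓝 0) := by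
    filter_upwards [hfB] with x hx
    simp only [T_smul_apply, havg] at hx
    rw [show ∫ y, B.indicator (1 : AddCircle (1 : ℝ) → ℂ) y = ((p / 2 : ℝ) : ℂ) by
      have h := integral_indicator_const (μ := volume) (1 : ℂ) hBm
      rw [Complex.real_smul, mul_one, hBv] at h
      exact h, tendsto_ofReal_iff] at hx
    refine tendsto_const_nhds.congr' ?_
    filter_upwards [hx.eventually_lt_const (half_lt_self hp0)] with t ht
    rw [Set.indicator_of_notMem]
    refine fun hmem => ht.not_ge (measureReal_mono fun α (hα : _ = c) => ?_)
    rwa [Set.mem_preimage, hα]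
  have hint : Tendsto (fun t : ℝ => ∫ x, B.indicator (1 : AddCircle (1 : ℝ) → ℝ)
      (x + ((t * c : ℝ) : AddCircle (1 : ℝ)))) (atTop ⊓ 𝓟 A)
      (𝓝 (∫ _ : AddCircle (1 : ℝ), 0)) := by
    refine tendsto_integral_filter_of_dominated_convergence (fun _ => 1)
      (.of_forall fun t => ?_) (.of_forall fun t => ae_of_all _ fun x => ?_)
      (integrable_const _) hlim
    · exact ((measurable_one.indicator hBm).comp (measurable_add_const _)).aestronglyMeasurable
    · exact (norm_indicator_le_norm_self _ _).trans (by simp)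
  simp only [integral_add_right_eq_self (B.indicator (1 : AddCircle (1 : ℝ) → ℝ)),
    integral_indicator_one hBm, hBv, integral_zero] at hint
  linarith [tendsto_nhds_unique tendsto_const_nhds hint]

end circleRotationSystem

/-- The rotation system `T_α x = x + α·β` on the circle `ℝ/ℤ` is an
ergodic `ℝ^m`-system, is good for double Birkhoff averages, and no Borel probability
measure `ν` giving positive mass to the hyperplane `{α : α·β = c}` is weakly
equidistributed for it. -/
theorem circle_system_ergodic_good_and_hyperplane_mass_obstructs
    (m : ℕ) (β : Fin m → ℝ) (hβ : β ≠ 0) (c : ℝ) :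
    ∃ S : RSystem m (AddCircle (1:ℝ)) volume,
      (∀ (α : Fin m → ℝ) (x : AddCircle (1:ℝ)),
          S.T α x = x + ((∑ i, α i * β i : ℝ) : AddCircle (1:ℝ))) ∧
      S.IsErgodic ∧ S.GoodForDoubleBirkhoff ∧
      ∀ ν : Measure (Fin m → ℝ), IsProbabilityMeasure ν →
        0 < ν {α : Fin m → ℝ | ∑ i, α i * β i = c} →
        ¬ S.WeaklyEquidistributed ν :=
  ⟨circleRotationSystem β, circleRotationSystem.T_apply β, circleRotationSystem.isErgodic β hβ,
    circleRotationSystem.goodForDoubleBirkhoff β,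
    fun ν _ hν => circleRotationSystem.not_weaklyEquidistributed β c ν hν⟩
end
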